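/- arXiv:1507.05030 — 2 statements merged into one kernel-verified Lean document; each statement's English description precedes it below -/
import Mathlib

section
/- Let U ⊆ ℝⁿ be open and connected and let u ∈ C²(U) with u > 0 be relativistically subharmonic, i.e., div(u Du/√(u²+|Du|²)) ≥ 0 on U. If u attains an interior maximum at some point of U, then u is constant on U. -/
open Real Set

/-- Partial derivative of `f` in the `i`-th coordinate direction. -/
noncomputable def pd {n : ℕ} (f : EuclideanSpace ℝ (Fin n) → ℝ) (i : Fin n)
    (x : EuclideanSpace ℝ (Fin n)) : ℝ :=
  fderiv ℝ f x (EuclideanSpace.single i 1)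

/-- Squared norm of the gradient of `f` at `x`. -/
noncomputable def gradNormSq {n : ℕ} (f : EuclideanSpace ℝ (Fin n) → ℝ)
    (x : EuclideanSpace ℝ (Fin n)) : ℝ :=
  ∑ i, (pd f i x) ^ 2

/-- The divergence of the relativistic heat flux `u Du / √(u² + |Du|²)`. -/
noncomputable def relDiv {n : ℕ} (u : EuclideanSpace ℝ (Fin n) → ℝ)
    (x : EuclideanSpace ℝ (Fin n)) : ℝ :=
  ∑ i, pd (fun y => u y * pd u i y / Real.sqrt ((u y) ^ 2 + gradNormSq u y)) i x

/-- The transformed quasilinear operator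
`Q w = Δw − D²w(Dw,Dw)/(1+|Dw|²) + |Dw|²`. -/
noncomputable def Qop {n : ℕ} (w : EuclideanSpace ℝ (Fin n) → ℝ)
    (x : EuclideanSpace ℝ (Fin n)) : ℝ :=
  (∑ i, pd (pd w i) i x)
    - (∑ i, ∑ j, pd (pd w i) j x * pd w i x * pd w j x) / (1 + gradNormSq w x)
    + gradNormSq w x


open Filter Topology

lemma aux_1d (g g1 : ℝ → ℝ) (g2 : ℝ) (h1 : ∀ᶠ t in 𝓝 (0:ℝ), HasDerivAt g (g1 t) t)
    (h2 : HasDerivAt g1 g2 0) (hm : IsLocalMax g 0) : g1 0 = 0 ∧ g2 ≤ 0 := by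
  have e0 : g1 0 = 0 := hm.hasDerivAt_eq_zero h1.self_of_nhds
  refine ⟨e0, ?_⟩
  by_contra! hpos
  have hd : deriv g =ᶠ[𝓝 0] g1 := h1.mono fun t ht => ht.deriv
  have hdd : deriv (deriv g) 0 = g2 := by rw [hd.deriv_eq, h2.deriv]
  have hmin : IsLocalMin g 0 := isLocalMin_of_deriv_deriv_pos (by rw [hdd]; exact hpos)
    (by rw [hd.self_of_nhds, e0]) h1.self_of_nhds.continuousAt
  have hc : g =ᶠ[𝓝 0] fun _ => g 0 := by
    filter_upwards [hmin, hm] with t a b using le_antisymm b a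
  have hc1 : deriv g =ᶠ[𝓝 0] fun _ => 0 := by
    have := hc.deriv
    simpa using this
  have : deriv (deriv g) 0 = 0 := by rw [hc1.deriv_eq]; simp
  linarith

lemma aux_line {n : ℕ} (u : EuclideanSpace ℝ (Fin n) → ℝ) (z c w : EuclideanSpace ℝ (Fin n))
    (hu : ContDiffAt ℝ 2 u z) (ε α : ℝ)
    (hm : IsLocalMax (fun x => u x + ε * Real.exp (-α * ‖x - c‖ ^ 2)) z) :
    fderiv ℝ u z w = 2 * α * ε * Real.exp (-α * ‖z - c‖ ^ 2) * inner ℝ (z - c) w ∧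
    fderiv ℝ (fderiv ℝ u) z w w ≤ -(ε * Real.exp (-α * ‖z - c‖ ^ 2) *
      (4 * α ^ 2 * (inner ℝ (z - c) w) ^ 2 - 2 * α * ‖w‖ ^ 2)) := by
  have hline : ∀ t : ℝ, HasDerivAt (fun t : ℝ => z + t • w) w t := fun t => by
    simpa using ((hasDerivAt_id t).smul_const w).const_add z
  have hcont : Tendsto (fun t : ℝ => z + t • w) (𝓝 0) (𝓝 z) := by
    have := (hline 0).continuousAt.tendsto
    simpa using this
  set a := ‖z - c‖ ^ 2 with ha
  set b := inner ℝ (z - c) w with hb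
  set k := ‖w‖ ^ 2 with hk
  have hnorm : ∀ t : ℝ, ‖z + t • w - c‖ ^ 2 = a + 2 * b * t + k * t ^ 2 := fun t => by
    have : z + t • w - c = (z - c) + t • w := by abel
    rw [this, norm_add_sq_real, inner_smul_right, norm_smul, mul_pow, Real.norm_eq_abs, sq_abs]
    ring
  have hdu : ∀ᶠ x in 𝓝 z, DifferentiableAt ℝ u x := by
    have := hu.eventually (by simp)
    filter_upwards [this] with x hx using hx.differentiableAt (by norm_num)
  have hd2 : DifferentiableAt ℝ (fderiv ℝ u) z :=
    (hu.fderiv_right (m := 1) (by norm_num)).differentiableAt (by norm_num)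
  have hq : ∀ t : ℝ, HasDerivAt (fun t : ℝ => -α * (a + 2 * b * t + k * t ^ 2))
      (-α * (2 * b + 2 * k * t)) t := fun t => by
    have h := ((((hasDerivAt_id t).const_mul (2 * b)).const_add a).add
      (((hasDerivAt_id t).pow 2).const_mul k)).const_mul (-α)
    refine h.congr_deriv ?_
    simp only [id]; push_cast; ring
  have key := aux_1d (fun t => u (z + t • w) + ε * Real.exp (-α * (a + 2 * b * t + k * t ^ 2)))
    (fun t => fderiv ℝ u (z + t • w) w +
      ε * (Real.exp (-α * (a + 2 * b * t + k * t ^ 2)) * (-α * (2 * b + 2 * k * t))))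
    (fderiv ℝ (fderiv ℝ u) z w w + ε * ((Real.exp (-α * a) * (-α * (2 * b))) * (-α * (2 * b))
      + Real.exp (-α * a) * (-α * (2 * k)))) ?_ ?_ ?_
  · obtain ⟨k1, k2⟩ := key
    simp only [zero_smul, add_zero, mul_zero, ne_eq, OfNat.ofNat_ne_zero, not_false_eq_true,
      zero_pow] at k1
    constructor
    · linarith
    · linarith
  · filter_upwards [hcont.eventually hdu] with t ht
    exact (ht.hasFDerivAt.comp_hasDerivAt t (hline t)).add ((hq t).exp.const_mul ε)
  · have h1 : HasDerivAt (fun t : ℝ => fderiv ℝ u (z + t • w)) (fderiv ℝ (fderiv ℝ u) z w) 0 := by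
      have : HasFDerivAt (fderiv ℝ u) (fderiv ℝ (fderiv ℝ u) z) (z + (0:ℝ) • w) := by
        simpa using hd2.hasFDerivAt
      exact this.comp_hasDerivAt 0 (hline 0)
    have h2 := h1.clm_apply (hasDerivAt_const (0:ℝ) w)
    have h3 : HasDerivAt (fun t : ℝ => -α * (2 * b + 2 * k * t)) (-α * (2 * k)) 0 := by
      have := (((hasDerivAt_id (0:ℝ)).const_mul (2 * k)).const_add (2 * b)).const_mul (-α)
      simpa using this
    have h4 := h2.add (((hq 0).exp.mul h3).const_mul ε)
    refine h4.congr_deriv ?_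
    simp
  · have : IsLocalMax ((fun x => u x + ε * Real.exp (-α * ‖x - c‖ ^ 2)) ∘
        (fun t : ℝ => z + t • w)) 0 := by
      have h0 : IsLocalMax (fun x => u x + ε * Real.exp (-α * ‖x - c‖ ^ 2)) (z + (0:ℝ) • w) := by
        simpa using hm
      exact IsLocalMax.comp_continuous (g := fun t : ℝ => z + t • w) h0 (hline 0).continuousAt
    simpa only [Function.comp_def, hnorm] using this

lemma aux_relDiv {n : ℕ} (u : EuclideanSpace ℝ (Fin n) → ℝ) (x : EuclideanSpace ℝ (Fin n))
    (hu : ContDiffAt ℝ 2 u x) (hpos : 0 < u x) (hs : 0 ≤ relDiv u x) :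
    0 ≤ (gradNormSq u x) ^ 2 + u x * ((u x ^ 2 + gradNormSq u x) * ∑ i, pd (pd u i) i x
      - ∑ i, ∑ j, pd (pd u j) i x * pd u i x * pd u j x) := by
  have hd2 : DifferentiableAt ℝ (fderiv ℝ u) x :=
    (hu.fderiv_right (m := 1) (by norm_num)).differentiableAt (by norm_num)
  have hdu : HasFDerivAt u (fderiv ℝ u x) x := (hu.differentiableAt (by norm_num)).hasFDerivAt
  have hp : ∀ i, HasFDerivAt (pd u i) (fderiv ℝ (pd u i) x) x := fun i => by
    have : DifferentiableAt ℝ (pd u i) x := by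
      unfold pd
      exact hd2.clm_apply (differentiableAt_const _)
    exact this.hasFDerivAt
  set W := u x ^ 2 + gradNormSq u x with hW
  have hg0 : 0 ≤ gradNormSq u x := Finset.sum_nonneg fun i _ => sq_nonneg _
  have hWpos : 0 < W := by positivity
  have hs0 : 0 < Real.sqrt W := Real.sqrt_pos.2 hWpos
  have hsq : Real.sqrt W ^ 2 = W := Real.sq_sqrt hWpos.le
  have hWd : HasFDerivAt (fun y => u y ^ 2 + gradNormSq u y)
      ((2 * u x) • fderiv ℝ u x + ∑ j, (2 * pd u j x) • fderiv ℝ (pd u j) x) x := by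
    unfold gradNormSq
    refine HasFDerivAt.add ?_ (HasFDerivAt.fun_sum fun j _ => ?_)
    · simpa using hdu.pow 2
    · simpa using (hp j).pow 2
  have hterm : ∀ i, pd (fun y => u y * pd u i y / Real.sqrt ((u y) ^ 2 + gradNormSq u y)) i x
      * Real.sqrt W ^ 3 = W * (pd u i x ^ 2 + u x * pd (pd u i) i x)
        - u x * pd u i x * (u x * pd u i x + ∑ j, pd u j x * pd (pd u j) i x) := by
    intro i
    have hI := (hasDerivAt_inv hs0.ne').comp_hasFDerivAt x (hWd.sqrt hWpos.ne')
    have hF := (hdu.mul (hp i)).mul hI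
    have hFe : pd (fun y => u y * pd u i y / Real.sqrt ((u y) ^ 2 + gradNormSq u y)) i x
        = _ := DFunLike.congr_fun hF.fderiv (EuclideanSpace.single i 1)
    rw [hFe]
    have e3 : (∑ j, (2 * pd u j x) • fderiv ℝ (pd u j) x) (EuclideanSpace.single i 1)
        = 2 * ∑ j, pd u j x * pd (pd u j) i x := by
      rw [sum_apply, Finset.mul_sum]
      refine Finset.sum_congr rfl fun j _ => ?_
      simp [pd]; ring
    simp only [Pi.mul_apply, Function.comp, smul_apply, add_apply, e3, smul_eq_mul]
    rw [← hW]
    change (_ * (_ * (_ * (_ * pd u i x + _))) +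
      _ * (u x * pd (pd u i) i x + pd u i x * pd u i x)) * _ = _
    generalize ∑ j, pd u j x * pd (pd u j) i x = S
    have hW2 : W = Real.sqrt W ^ 2 := hsq.symm
    have hs1 := hs0.ne'
    clear hsq hI hF hFe hs0 e3
    generalize Real.sqrt W = s at *
    rw [hW2]
    field_simp
    ring
  have hsum : relDiv u x * Real.sqrt W ^ 3 = (gradNormSq u x) ^ 2 + u x * (W * ∑ i, pd (pd u i) i x
      - ∑ i, ∑ j, pd (pd u j) i x * pd u i x * pd u j x) := by
    unfold relDiv
    rw [Finset.sum_mul, Finset.sum_congr rfl fun i _ => hterm i]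
    have e1 : ∑ i, ∑ j, pd (pd u j) i x * pd u i x * pd u j x
        = ∑ i, pd u i x * ∑ j, pd u j x * pd (pd u j) i x := by
      refine Finset.sum_congr rfl fun i _ => ?_
      rw [Finset.mul_sum]
      exact Finset.sum_congr rfl fun j _ => by ring
    rw [e1]
    have e2 : ∀ i, W * (pd u i x ^ 2 + u x * pd (pd u i) i x)
        - u x * pd u i x * (u x * pd u i x + ∑ j, pd u j x * pd (pd u j) i x)
        = gradNormSq u x * pd u i x ^ 2 + u x * W * pd (pd u i) i x
          - u x * (pd u i x * ∑ j, pd u j x * pd (pd u j) i x) := fun i => by rw [hW]; ring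
    rw [Finset.sum_congr rfl fun i _ => e2 i, Finset.sum_sub_distrib, Finset.sum_add_distrib,
      ← Finset.mul_sum, ← Finset.mul_sum, ← Finset.mul_sum]
    change gradNormSq u x * gradNormSq u x + _ - _ = _
    ring
  rw [← hsum]
  positivity

lemma aux_point {n : ℕ} (u : EuclideanSpace ℝ (Fin n) → ℝ) (z c : EuclideanSpace ℝ (Fin n))
    (hu : ContDiffAt ℝ 2 u z) (hpos : 0 < u z) (hs : 0 ≤ relDiv u z) (ε α : ℝ) (hε : 0 < ε)
    (hα : 0 < α) (hm : IsLocalMax (fun x => u x + ε * Real.exp (-α * ‖x - c‖ ^ 2)) z) (l r : ℝ)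
    (hl : l = 2 * α * ε * Real.exp (-α * ‖z - c‖ ^ 2)) (hr : r = ‖z - c‖ ^ 2) :
    0 ≤ l ^ 3 * r ^ 2 + u z ^ 3 * (n - 2 * α * r) + n * u z * l ^ 2 * r := by
  have hlpos : 0 < l := by rw [hl]; positivity
  have h1 := aux_relDiv u z hu hpos hs
  have h2 := fun w => aux_line u z c w hu ε α hm
  have hd2 : DifferentiableAt ℝ (fderiv ℝ u) z :=
    (hu.fderiv_right (m := 1) (by norm_num)).differentiableAt (by norm_num)
  set B := fderiv ℝ (fderiv ℝ u) z with hB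
  have hpp : ∀ i j, pd (pd u j) i z
      = B (EuclideanSpace.single i 1) (EuclideanSpace.single j 1) := fun i j => by
    have h := (hd2.hasFDerivAt.clm_apply
      (hasFDerivAt_const (EuclideanSpace.single j (1:ℝ)) z)).fderiv
    have h' := DFunLike.congr_fun h (EuclideanSpace.single i 1)
    change fderiv ℝ (fun y => fderiv ℝ u y (EuclideanSpace.single j 1)) z _ = _
    rw [h']
    simp [hB]
  have hp : ∀ i, pd u i z = l * (z - c) i := fun i => by
    have := (h2 (EuclideanSpace.single i 1)).1
    rw [← hl] at this
    unfold pd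
    rw [this]
    simp [EuclideanSpace.inner_single_right]
  have hrs : r = ∑ i, (z - c) i ^ 2 := by
    rw [hr, EuclideanSpace.norm_sq_eq]
    simp
  have hg : gradNormSq u z = l ^ 2 * r := by
    unfold gradNormSq
    rw [hrs, Finset.mul_sum]
    exact Finset.sum_congr rfl fun i _ => by rw [hp i]; ring
  have hdiag : ∀ i, B (EuclideanSpace.single i 1) (EuclideanSpace.single i 1)
      ≤ l - 2 * α * l * (z - c) i ^ 2 := fun i => by
    have := (h2 (EuclideanSpace.single i 1)).2
    simp only [EuclideanSpace.inner_single_right, EuclideanSpace.norm_single] at this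
    refine this.trans (le_of_eq ?_)
    rw [hl]
    simp
    ring
  have hoff : ∀ i j, pd u i z ^ 2 * B (EuclideanSpace.single j 1) (EuclideanSpace.single j 1)
      + pd u j z ^ 2 * B (EuclideanSpace.single i 1) (EuclideanSpace.single i 1)
      - B (EuclideanSpace.single i 1) (EuclideanSpace.single j 1) * pd u i z * pd u j z
      - B (EuclideanSpace.single j 1) (EuclideanSpace.single i 1) * pd u j z * pd u i z
      ≤ l * (pd u i z ^ 2 + pd u j z ^ 2) := fun i j => by
    have h := (h2 (pd u i z • EuclideanSpace.single j 1 - pd u j z • EuclideanSpace.single i 1)).2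
    have hin : inner ℝ (z - c)
        (pd u i z • EuclideanSpace.single j (1:ℝ) - pd u j z • EuclideanSpace.single i (1:ℝ)) = 0 := by
      rw [inner_sub_right, inner_smul_right, inner_smul_right,
        EuclideanSpace.inner_single_right, EuclideanSpace.inner_single_right, hp, hp]
      simp
      ring
    have hno : ‖pd u i z • EuclideanSpace.single j (1:ℝ) - pd u j z • EuclideanSpace.single i (1:ℝ)‖ ^ 2
        ≤ pd u i z ^ 2 + pd u j z ^ 2 := by
      by_cases hij : i = j
      · subst hij
        simp
        positivity
      · rw [norm_sub_sq_real, inner_smul_left, inner_smul_right, norm_smul, norm_smul,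
          EuclideanSpace.inner_single_right]
        simp [hij]
    rw [hin] at h
    have h' := mul_le_mul_of_nonneg_left hno hlpos.le
    rw [hl] at h' ⊢
    simp only [map_sub, map_smul, sub_apply, smul_apply,
      smul_eq_mul] at h
    linarith
  have S1 : ∑ i, B (EuclideanSpace.single i 1) (EuclideanSpace.single i 1)
      ≤ n * l - 2 * α * l * r := by
    refine (Finset.sum_le_sum fun i _ => hdiag i).trans (le_of_eq ?_)
    rw [Finset.sum_sub_distrib, ← Finset.mul_sum, ← hrs]
    simp
  have S2 := Finset.sum_le_sum fun i (_ : i ∈ Finset.univ) =>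
    Finset.sum_le_sum fun j (_ : j ∈ Finset.univ) => hoff i j
  have hcomm : ∑ i, ∑ j, B (EuclideanSpace.single j 1) (EuclideanSpace.single i 1) * pd u j z * pd u i z
    = ∑ i, ∑ j, B (EuclideanSpace.single i 1) (EuclideanSpace.single j 1) * pd u i z * pd u j z :=
    Finset.sum_comm
  have hgs : ∑ i, pd u i z ^ 2 = l ^ 2 * r := hg
  simp only [Finset.sum_sub_distrib, Finset.sum_add_distrib] at S2
  rw [hcomm] at S2
  simp only [← Finset.mul_sum,
    ← Finset.sum_mul, hgs, Finset.sum_add_distrib, Finset.sum_const, Finset.card_univ, Fintype.card_fin, nsmul_eq_mul] at S2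
  simp only [hpp, hg] at h1
  generalize ∑ i, ∑ j, B (EuclideanSpace.single i 1) (EuclideanSpace.single j 1) * pd u i z * pd u j z
    = X at *
  generalize ∑ i, B (EuclideanSpace.single i 1) (EuclideanSpace.single i 1) = T at *
  have S3 : l ^ 2 * r * T - X ≤ n * l * (l ^ 2 * r) := by linarith
  have S4 : u z ^ 2 * T ≤ u z ^ 2 * (n * l - 2 * α * l * r) :=
    mul_le_mul_of_nonneg_left S1 (by positivity)
  have S5 : u z * ((u z ^ 2 + l ^ 2 * r) * T - X)
      ≤ u z * (u z ^ 2 * (n * l - 2 * α * l * r) + n * l * (l ^ 2 * r)) :=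
    mul_le_mul_of_nonneg_left (by linarith) hpos.le
  have S6 : 0 ≤ l * (l ^ 3 * r ^ 2 + u z ^ 3 * (n - 2 * α * r) + n * u z * l ^ 2 * r) := by
    linarith
  exact nonneg_of_mul_nonneg_right S6 hlpos

/-- Touching-ball contradiction. -/
lemma aux_hopf {n : ℕ} (U : Set (EuclideanSpace ℝ (Fin n)))
    (hU : IsOpen U) (u : EuclideanSpace ℝ (Fin n) → ℝ)
    (hu : ContDiffOn ℝ 2 u U) (hupos : ∀ x ∈ U, 0 < u x)
    (hsub : ∀ x ∈ U, 0 ≤ relDiv u x) (M : ℝ) (hmax : ∀ x ∈ U, u x ≤ M)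
    (c y : EuclideanSpace ℝ (Fin n)) (R : ℝ) (hR : 0 < R) (hyR : dist y c = R)
    (hyM : u y = M) (hball : Metric.closedBall y (R / 2) ⊆ U)
    (hlt : ∀ x ∈ U, dist x c ≤ R → x ≠ y → u x < M) : False := by
  have hcu : ContinuousOn u (Metric.closedBall y (R / 2)) := hu.continuousOn.mono hball
  have hyB : y ∈ Metric.closedBall y (R / 2) := Metric.mem_closedBall_self (by positivity)
  have hcomp : IsCompact (Metric.closedBall y (R / 2)) := isCompact_closedBall _ _
  obtain ⟨q, hq, hqmin⟩ := hcomp.exists_isMinOn ⟨y, hyB⟩ hcu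
  have hm0 : 0 < u q := hupos q (hball hq)
  have hM0 : 0 < M := hyM ▸ hupos y (hball hyB)
  -- gap on the part of the sphere inside the touching ball
  obtain ⟨η, hη, hgap⟩ : ∃ η > 0, ∀ x ∈ Metric.sphere y (R / 2) ∩ Metric.closedBall c R,
      u x ≤ M - η := by
    have hT : IsCompact (Metric.sphere y (R / 2) ∩ Metric.closedBall c R) :=
      (isCompact_sphere _ _).inter_right Metric.isClosed_closedBall
    rcases (Metric.sphere y (R / 2) ∩ Metric.closedBall c R).eq_empty_or_nonempty with he | hne
    · exact ⟨1, one_pos, fun x hx => by rw [he] at hx; exact hx.elim⟩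
    · obtain ⟨s, hs, hsmax⟩ := hT.exists_isMaxOn hne
        (hcu.mono (inter_subset_left.trans Metric.sphere_subset_closedBall))
      refine ⟨M - u s, sub_pos.2 (hlt s (hball (Metric.sphere_subset_closedBall hs.1)) hs.2 ?_),
        fun x hx => ?_⟩
      · rintro rfl
        have := hs.1
        simp at this
        linarith
      · have : u x ≤ u s := hsmax hx
        linarith
  set α : ℝ := 2 * (n + 1) / R ^ 2 with hα
  have hα0 : 0 < α := by positivity
  obtain ⟨ε, hε, hεη, hεs⟩ : ∃ ε > 0, ε ≤ η ∧
      (2 * α * ε) ^ 3 * ((3 * R / 2) ^ 2) ^ 2 + n * M * (2 * α * ε) ^ 2 * (3 * R / 2) ^ 2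
        < u q ^ 3 := by
    have ht : Tendsto (fun ε : ℝ => (2 * α * ε) ^ 3 * ((3 * R / 2) ^ 2) ^ 2
        + n * M * (2 * α * ε) ^ 2 * (3 * R / 2) ^ 2) (𝓝[>] 0) (𝓝 0) := by
      have hc : Continuous (fun ε : ℝ => (2 * α * ε) ^ 3 * ((3 * R / 2) ^ 2) ^ 2
        + n * M * (2 * α * ε) ^ 2 * (3 * R / 2) ^ 2) := by fun_prop
      have := hc.tendsto 0
      simp only [mul_zero, zero_mul, ne_eq, OfNat.ofNat_ne_zero, not_false_eq_true, zero_pow,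
        add_zero] at this
      exact this.mono_left nhdsWithin_le_nhds
    have h1 := ht.eventually (gt_mem_nhds (pow_pos hm0 3))
    have h2 : ∀ᶠ ε : ℝ in 𝓝[>] 0, ε ≤ η := nhdsWithin_le_nhds (Iic_mem_nhds hη)
    have h3 : ∀ᶠ ε : ℝ in 𝓝[>] 0, 0 < ε := self_mem_nhdsWithin
    obtain ⟨ε, ⟨a, b⟩, d⟩ := ((h1.and h2).and h3).exists
    exact ⟨ε, d, b, a⟩
  set h : EuclideanSpace ℝ (Fin n) → ℝ := fun x => u x + ε * Real.exp (-α * ‖x - c‖ ^ 2) with hh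
  have hch : ContinuousOn h (Metric.closedBall y (R / 2)) := by
    refine hcu.add (Continuous.continuousOn ?_)
    fun_prop
  obtain ⟨z, hz, hzmax⟩ := hcomp.exists_isMaxOn ⟨y, hyB⟩ hch
  have hzy : h y ≤ h z := hzmax hyB
  have hy : h y = M + ε * Real.exp (-α * R ^ 2) := by
    rw [hh]; simp only [hyM, ← dist_eq_norm, hyR]
  have hzb : z ∈ Metric.ball y (R / 2) := by
    rw [Metric.mem_ball]
    refine lt_of_le_of_ne hz fun hzs => ?_
    have hzz : h z = u z + ε * Real.exp (-α * dist z c ^ 2) := by rw [hh, dist_eq_norm]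
    rcases le_or_gt (dist z c) R with hc | hc
    · have g1 := hgap z ⟨hzs, hc⟩
      have g2 : Real.exp (-α * dist z c ^ 2) ≤ 1 := Real.exp_le_one_iff.2 (by
        have : 0 ≤ α * dist z c ^ 2 := by positivity
        linarith)
      have g3 := mul_le_mul_of_nonneg_left g2 hε.le
      have g4 : 0 < ε * Real.exp (-α * R ^ 2) := by positivity
      linarith
    · have g1 := hmax z (hball hz)
      have g2 : Real.exp (-α * dist z c ^ 2) < Real.exp (-α * R ^ 2) := by
        rw [Real.exp_lt_exp]
        have : R ^ 2 < dist z c ^ 2 := pow_lt_pow_left₀ hc hR.le (by norm_num)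
        have := mul_lt_mul_of_pos_left this hα0
        linarith
      have g3 := mul_lt_mul_of_pos_left g2 hε
      linarith
  have hloc : IsLocalMax h z :=
    hzmax.isLocalMax (Filter.mem_of_superset (Metric.isOpen_ball.mem_nhds hzb)
      Metric.ball_subset_closedBall)
  have hzU : z ∈ U := hball hz
  have key := aux_point u z c (hu.contDiffAt (hU.mem_nhds hzU)) (hupos z hzU) (hsub z hzU) ε α hε
    hα0 hloc _ _ rfl rfl
  have hzd : dist z y ≤ R / 2 := hz
  have d1 : R / 2 ≤ ‖z - c‖ := by
    rw [← dist_eq_norm]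
    have := dist_triangle y z c
    rw [dist_comm y z] at this
    linarith
  have d2 : ‖z - c‖ ≤ 3 * R / 2 := by
    rw [← dist_eq_norm]
    have := dist_triangle z y c
    linarith
  have d2' : ‖z - c‖ ^ 2 ≤ (3 * R / 2) ^ 2 := pow_le_pow_left₀ (norm_nonneg _) d2 2
  have d1' : (R / 2) ^ 2 ≤ ‖z - c‖ ^ 2 := pow_le_pow_left₀ (by positivity) d1 2
  have hl1 : 2 * α * ε * Real.exp (-α * ‖z - c‖ ^ 2) ≤ 2 * α * ε := by
    have g2 : Real.exp (-α * ‖z - c‖ ^ 2) ≤ 1 := Real.exp_le_one_iff.2 (by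
        have : 0 ≤ α * ‖z - c‖ ^ 2 := by positivity
        linarith)
    exact mul_le_of_le_one_right (by positivity) g2
  have hl0 : 0 ≤ 2 * α * ε * Real.exp (-α * ‖z - c‖ ^ 2) := by positivity
  have hr0 : 0 ≤ ‖z - c‖ ^ 2 := by positivity
  have huq : u q ≤ u z := hqmin hz
  have huM : u z ≤ M := hmax z hzU
  have huz : 0 < u z := hupos z hzU
  generalize 2 * α * ε * Real.exp (-α * ‖z - c‖ ^ 2) = l at *
  generalize ‖z - c‖ ^ 2 = r at *
  have k1 : l ^ 3 * r ^ 2 ≤ (2 * α * ε) ^ 3 * ((3 * R / 2) ^ 2) ^ 2 := by gcongr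
  have k2 : n * u z * l ^ 2 * r ≤ n * M * (2 * α * ε) ^ 2 * (3 * R / 2) ^ 2 := by gcongr
  have k3 : (n:ℝ) - 2 * α * r ≤ -1 := by
    have : α * (R / 2) ^ 2 ≤ α * r := mul_le_mul_of_nonneg_left d1' hα0.le
    have e : α * (R / 2) ^ 2 = (n + 1) / 2 := by rw [hα]; field_simp
    linarith
  have k4 : u z ^ 3 * (n - 2 * α * r) ≤ u z ^ 3 * (-1) :=
    mul_le_mul_of_nonneg_left k3 (by positivity)
  have k5 : u q ^ 3 ≤ u z ^ 3 := pow_le_pow_left₀ hm0.le huq 3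
  linarith

/-- strong maximum principle for relativistically subharmonic
functions on a connected open set. -/
theorem stmt7 {n : ℕ} (U : Set (EuclideanSpace ℝ (Fin n)))
    (hU : IsOpen U) (hconn : IsConnected U)
    (u : EuclideanSpace ℝ (Fin n) → ℝ)
    (hu : ContDiffOn ℝ 2 u U) (hupos : ∀ x ∈ U, 0 < u x)
    (hsub : ∀ x ∈ U, 0 ≤ relDiv u x)
    (x₀ : EuclideanSpace ℝ (Fin n)) (hx₀ : x₀ ∈ U)
    (hmax : ∀ x ∈ U, u x ≤ u x₀) :
    ∀ x ∈ U, u x = u x₀ := by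
  have hV : IsOpen (U ∩ u ⁻¹' Iio (u x₀)) := hu.continuousOn.isOpen_inter_preimage hU isOpen_Iio
  have hS : IsOpen {x | x ∈ U ∧ u x = u x₀} := by
    rw [Metric.isOpen_iff]
    rintro a ⟨haU, haM⟩
    obtain ⟨δ', hδ', hδU⟩ := Metric.isOpen_iff.1 hU a haU
    obtain ⟨δ, hδ, rfl⟩ : ∃ δ > 0, δ' = 4 * δ := ⟨δ' / 4, by positivity, by ring⟩
    refine ⟨δ, hδ, ?_⟩
    by_contra hnot
    rw [Set.not_subset] at hnot
    obtain ⟨c, hc, hcS⟩ := hnot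
    have hca : dist c a < δ := hc
    have hsubB : Metric.closedBall a (2 * δ) ⊆ U := fun x hx => hδU (by
      rw [Metric.mem_ball]; rw [Metric.mem_closedBall] at hx; linarith)
    have hK : IsCompact (Metric.closedBall a (2 * δ) ∩ u ⁻¹' {u x₀}) :=
      (isCompact_closedBall a (2 * δ)).of_isClosed_subset
        ((hu.continuousOn.mono hsubB).preimage_isClosed_of_isClosed
          Metric.isClosed_closedBall isClosed_singleton) inter_subset_left
    obtain ⟨y, ⟨hy1, hy2⟩, hymin⟩ := hK.exists_isMinOn
      ⟨a, Metric.mem_closedBall_self (by positivity), haM⟩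
      (f := fun x => dist x c) (by fun_prop)
    have hy2' : u y = u x₀ := hy2
    have hyU : y ∈ U := hsubB hy1
    have hya : dist y c ≤ dist a c := hymin
      (⟨Metric.mem_closedBall_self (by positivity), haM⟩ : a ∈ Metric.closedBall a (2 * δ) ∩ u ⁻¹' {u x₀})
    rw [dist_comm a c] at hya
    have hyc : 0 < dist y c := dist_pos.2 fun h => hcS ⟨h ▸ hyU, h ▸ hy2'⟩
    set R := dist y c with hRdef
    have hin : ∀ x ∈ U, dist x c < R → u x < u x₀ := fun x hx hxc => by
      refine lt_of_le_of_ne (hmax x hx) fun he => ?_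
      have hxB : x ∈ Metric.closedBall a (2 * δ) := by
        rw [Metric.mem_closedBall]
        linarith [dist_triangle x c a]
      have : R ≤ dist x c := hymin (⟨hxB, he⟩ : x ∈ Metric.closedBall a (2 * δ) ∩ u ⁻¹' {u x₀})
      linarith
    have hdy : ‖y - c‖ = R := by rw [← dist_eq_norm]
    have hmid : dist y ((1 / 2 : ℝ) • (c + y)) = R / 2 := by
      rw [dist_eq_norm]
      have : y - (1 / 2 : ℝ) • (c + y) = (1 / 2 : ℝ) • (y - c) := by module
      rw [this, norm_smul, hdy]
      norm_num
      ring
    refine aux_hopf U hU u hu hupos hsub (u x₀) hmax ((1 / 2 : ℝ) • (c + y)) y (R / 2)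
      (by positivity) hmid hy2' ?_ ?_
    · intro x hx
      refine hδU ?_
      rw [Metric.mem_closedBall] at hx
      rw [Metric.mem_closedBall] at hy1
      rw [Metric.mem_ball]
      linarith [dist_triangle x y a]
    · intro x hxU hxd hxy
      refine hin x hxU ?_
      have hpar := parallelogram_law_with_norm ℝ (x - (1 / 2 : ℝ) • (c + y)) ((1 / 2 : ℝ) • (y - c))
      have e1 : x - (1 / 2 : ℝ) • (c + y) + (1 / 2 : ℝ) • (y - c) = x - c := by module
      have e2 : x - (1 / 2 : ℝ) • (c + y) - (1 / 2 : ℝ) • (y - c) = x - y := by module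
      have e3 : ‖(1 / 2 : ℝ) • (y - c)‖ = R / 2 := by
        rw [norm_smul, hdy]; norm_num; ring
      rw [e1, e2, e3] at hpar
      rw [dist_eq_norm] at hxd
      have hpos : 0 < ‖x - y‖ := norm_pos_iff.2 (sub_ne_zero.2 hxy)
      have := mul_self_le_mul_self (norm_nonneg _) hxd
      rw [dist_eq_norm]
      refine lt_of_mul_self_lt_mul_self₀ hyc.le ?_
      nlinarith
  have hsubset := hconn.isPreconnected.subset_left_of_subset_union hS hV ?_ ?_ ⟨x₀, hx₀, hx₀, rfl⟩
  · exact fun x hx => (hsubset hx).2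
  · rw [Set.disjoint_left]
    rintro x ⟨_, h1⟩ ⟨_, h2⟩
    exact absurd h1 (ne_of_lt h2)
  · intro x hx
    rcases (hmax x hx).lt_or_eq with h | h
    · exact Or.inr ⟨hx, h⟩
    · exact Or.inl ⟨hx, h⟩
end

section
/- Every relativistically harmonic function is real analytic: if U ⊆ ℝⁿ is open and u ∈ C²(U) with u > 0 satisfies div(u Du/√(u²+|Du|²)) = 0 on U, then u is real analytic on U. -/
open Real Set

section
open Real Set

namespace RH

/-- Bounded `1/2`-Hölder functions as a subalgebra of all functions. -/
def holSub (E : Type) [MetricSpace E] : Subalgebra ℝ (E → ℝ) where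
  carrier := {f | ∃ C : ℝ, (∀ x, |f x| ≤ C) ∧ ∀ x y, |f x - f y| ≤ C * √(dist x y)}
  mul_mem' := by
    rintro f g ⟨C, hC, hC'⟩ ⟨D, hD, hD'⟩
    refine ⟨C * D + C * D, fun x => ?_, fun x y => ?_⟩
    · have h0 := abs_nonneg (f x)
      have h1 := abs_nonneg (g x)
      rw [Pi.mul_apply, abs_mul]
      nlinarith [hC x, hD x, mul_le_mul (hC x) (hD x) h1 (h0.trans (hC x)), mul_nonneg (h0.trans (hC x)) (h1.trans (hD x))]
    · have h0 := (abs_nonneg (f x)).trans (hC x)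
      have h1 := (abs_nonneg (g x)).trans (hD x)
      have e : (f * g) x - (f * g) y = f x * (g x - g y) + (f x - f y) * g y := by
        simp only [Pi.mul_apply]; ring
      rw [e]
      refine (abs_add_le _ _).trans ?_
      rw [abs_mul, abs_mul]
      have a1 := mul_le_mul (hC x) (hD' x y) (abs_nonneg _) h0
      have a2 := mul_le_mul (hC' x y) (hD y) (abs_nonneg _) (mul_nonneg h0 (Real.sqrt_nonneg _))
      linarith
  add_mem' := by
    rintro f g ⟨C, hC, hC'⟩ ⟨D, hD, hD'⟩
    refine ⟨C + D, fun x => ?_, fun x y => ?_⟩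
    · exact (abs_add_le _ _).trans (add_le_add (hC x) (hD x))
    · have e : (f + g) x - (f + g) y = (f x - f y) + (g x - g y) := by
        simp only [Pi.add_apply]; ring
      rw [e, add_mul]
      exact (abs_add_le _ _).trans (add_le_add (hC' x y) (hD' x y))
  algebraMap_mem' := by
    intro r
    refine ⟨|r|, fun x => ?_, fun x y => ?_⟩
    · simp
    · simp; positivity

/-- The Hölder algebra. -/
def Hol (E : Type) [MetricSpace E] : Type := holSub E

section
variable {E : Type} [MetricSpace E]

noncomputable instance : CommRing (Hol E) := inferInstanceAs (CommRing (holSub E))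
noncomputable instance : Algebra ℝ (Hol E) := inferInstanceAs (Algebra ℝ (holSub E))

/-- underlying function -/
def Hol.fn (f : Hol E) : E → ℝ := f.1

instance : CoeFun (Hol E) (fun _ => E → ℝ) := ⟨Hol.fn⟩

@[ext] theorem Hol.ext {f g : Hol E} (h : ∀ x, f x = g x) : f = g :=
  Subtype.ext (funext h)

@[simp] theorem Hol.add_apply (f g : Hol E) (x : E) : (f + g) x = f x + g x := rfl
@[simp] theorem Hol.mul_apply (f g : Hol E) (x : E) : (f * g) x = f x * g x := rfl
@[simp] theorem Hol.sub_apply (f g : Hol E) (x : E) : (f - g) x = f x - g x := rfl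
@[simp] theorem Hol.neg_apply (f : Hol E) (x : E) : (-f) x = -f x := rfl
@[simp] theorem Hol.zero_apply (x : E) : (0 : Hol E) x = 0 := rfl
@[simp] theorem Hol.one_apply (x : E) : (1 : Hol E) x = 1 := rfl
@[simp] theorem Hol.smul_apply (c : ℝ) (f : Hol E) (x : E) : (c • f) x = c * f x := rfl
@[simp] theorem Hol.algebraMap_apply (c : ℝ) (x : E) : (algebraMap ℝ (Hol E) c) x = c := rfl

/-- sup norm -/
noncomputable def Hol.sup (f : Hol E) : ℝ := ⨆ x, |f x|
/-- Hölder seminorm -/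
noncomputable def Hol.semi (f : Hol E) : ℝ := ⨆ p : E × E, |f p.1 - f p.2| / √(dist p.1 p.2)

theorem Hol.le_sup (f : Hol E) (x : E) : |f x| ≤ f.sup := by
  obtain ⟨C, hC, _⟩ := f.2
  exact le_ciSup (f := fun x => |f x|) ⟨C, by rintro _ ⟨x, rfl⟩; exact hC x⟩ x

theorem Hol.le_semi (f : Hol E) (x y : E) : |f x - f y| ≤ f.semi * √(dist x y) := by
  obtain ⟨C, hC0, hC⟩ := f.2
  rcases eq_or_ne x y with rfl | hxy
  · simp
  have hp : 0 < √(dist x y) := Real.sqrt_pos.2 (dist_pos.2 hxy)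
  rw [← div_le_iff₀ hp]
  refine le_ciSup (f := fun p : E × E => |f p.1 - f p.2| / √(dist p.1 p.2)) ⟨C, ?_⟩ (x, y)
  rintro _ ⟨p, rfl⟩
  have hCn : 0 ≤ C := (abs_nonneg _).trans (hC0 x)
  exact div_le_of_le_mul₀ (Real.sqrt_nonneg _) hCn (hC _ _)

theorem Hol.sup_nonneg (f : Hol E) : 0 ≤ f.sup := Real.iSup_nonneg fun _ => abs_nonneg _
theorem Hol.semi_nonneg (f : Hol E) : 0 ≤ f.semi := Real.iSup_nonneg fun _ => by positivity

theorem Hol.sup_le {f : Hol E} {C : ℝ} (hC : 0 ≤ C) (h : ∀ x, |f x| ≤ C) : f.sup ≤ C :=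
  Real.iSup_le h hC
theorem Hol.semi_le {f : Hol E} {C : ℝ} (hC : 0 ≤ C)
    (h : ∀ x y, |f x - f y| ≤ C * √(dist x y)) : f.semi ≤ C :=
  Real.iSup_le (fun p => div_le_of_le_mul₀ (Real.sqrt_nonneg _) hC (h _ _)) hC

/-- the norm -/
noncomputable def Hol.nrm : AddGroupNorm (Hol E) where
  toFun f := f.sup + f.semi
  map_zero' := by simp [Hol.sup, Hol.semi]
  add_le' f g := by
    have h1 : (f + g).sup ≤ f.sup + g.sup :=
      Hol.sup_le (add_nonneg f.sup_nonneg g.sup_nonneg) fun x =>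
        (abs_add_le _ _).trans (add_le_add (f.le_sup x) (g.le_sup x))
    have h2 : (f + g).semi ≤ f.semi + g.semi :=
      Hol.semi_le (add_nonneg f.semi_nonneg g.semi_nonneg) fun x y => by
        have e : (f + g) x - (f + g) y = (f x - f y) + (g x - g y) := by
          simp only [Hol.add_apply]; ring
        rw [e, add_mul]
        exact (abs_add_le _ _).trans (add_le_add (f.le_semi x y) (g.le_semi x y))
    linarith
  neg' f := by
    have e : ∀ a b : ℝ, |-a - -b| = |a - b| := fun a b => by
      rw [← abs_neg]; ring_nf
    simp only [Hol.sup, Hol.semi, Hol.neg_apply, abs_neg, e]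
  eq_zero_of_map_eq_zero' f h := by
    ext x
    have := f.le_sup x
    have h2 := f.semi_nonneg
    have h3 := abs_nonneg (f x)
    have : |f x| = 0 := by linarith
    simpa using this

noncomputable instance : NormedCommRing (Hol E) :=
  { (inferInstance : CommRing (Hol E)), AddGroupNorm.toNormedAddCommGroup (Hol.nrm (E := E)) with
    norm_mul_le := by
      intro f g
      change (f * g).sup + (f * g).semi ≤ (f.sup + f.semi) * (g.sup + g.semi)
      have h1 : (f * g).sup ≤ f.sup * g.sup :=
        Hol.sup_le (mul_nonneg f.sup_nonneg g.sup_nonneg) fun x => by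
          rw [Hol.mul_apply, abs_mul]
          exact mul_le_mul (f.le_sup x) (g.le_sup x) (abs_nonneg _) f.sup_nonneg
      have h2 : (f * g).semi ≤ f.sup * g.semi + f.semi * g.sup :=
        Hol.semi_le (add_nonneg (mul_nonneg f.sup_nonneg g.semi_nonneg)
          (mul_nonneg f.semi_nonneg g.sup_nonneg)) fun x y => by
          have e : (f * g) x - (f * g) y = f x * (g x - g y) + (f x - f y) * g y := by
            simp only [Hol.mul_apply]; ring
          rw [e]
          refine (abs_add_le _ _).trans ?_
          rw [abs_mul, abs_mul]
          have a1 := mul_le_mul (f.le_sup x) (g.le_semi x y) (abs_nonneg _) f.sup_nonneg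
          have a2 := mul_le_mul (f.le_semi x y) (g.le_sup y) (abs_nonneg _)
            (mul_nonneg f.semi_nonneg (Real.sqrt_nonneg _))
          linarith
      have := mul_nonneg f.semi_nonneg g.semi_nonneg
      linarith }

theorem Hol.norm_def (f : Hol E) : ‖f‖ = f.sup + f.semi := rfl

theorem Hol.abs_le (f : Hol E) (x : E) : |f x| ≤ ‖f‖ := by
  have := f.le_sup x; have := f.semi_nonneg; rw [Hol.norm_def]; linarith

theorem Hol.holder (f : Hol E) (x y : E) : |f x - f y| ≤ ‖f‖ * √(dist x y) := by
  refine (f.le_semi x y).trans (mul_le_mul_of_nonneg_right ?_ (Real.sqrt_nonneg _))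
  have := f.sup_nonneg; rw [Hol.norm_def]; linarith

theorem Hol.norm_le {f : Hol E} {A B : ℝ} (hA : 0 ≤ A) (hB : 0 ≤ B) (h : ∀ x, |f x| ≤ A)
    (h' : ∀ x y, |f x - f y| ≤ B * √(dist x y)) : ‖f‖ ≤ A + B :=
  add_le_add (Hol.sup_le hA h) (Hol.semi_le hB h')

noncomputable instance : NormedAlgebra ℝ (Hol E) where
  norm_smul_le c f := by
    have : ‖c • f‖ ≤ |c| * f.sup + |c| * f.semi := by
      refine Hol.norm_le (mul_nonneg (abs_nonneg _) f.sup_nonneg)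
        (mul_nonneg (abs_nonneg _) f.semi_nonneg) (fun x => ?_) (fun x y => ?_)
      · rw [Hol.smul_apply, abs_mul]
        exact mul_le_mul_of_nonneg_left (f.le_sup x) (abs_nonneg _)
      · rw [Hol.smul_apply, Hol.smul_apply, ← mul_sub, abs_mul, mul_assoc]
        exact mul_le_mul_of_nonneg_left (f.le_semi x y) (abs_nonneg _)
    rw [Real.norm_eq_abs, Hol.norm_def f, mul_add]
    exact this

/-- construct an element -/
def Hol.mk (f : E → ℝ) (h : ∃ C : ℝ, (∀ x, |f x| ≤ C) ∧ ∀ x y, |f x - f y| ≤ C * √(dist x y)) :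
    Hol E := ⟨f, h⟩

@[simp] theorem Hol.mk_apply (f : E → ℝ) (h) (x : E) : (Hol.mk f h) x = f x := rfl

theorem Hol.continuous (f : Hol E) : Continuous f := by
  rw [Metric.continuous_iff']
  intro a ε hε
  have : Filter.Tendsto (fun x => ‖f‖ * √(dist x a)) (nhds a) (nhds 0) := by
    have : Continuous fun x => ‖f‖ * √(dist x a) := by fun_prop
    simpa using this.tendsto a
  filter_upwards [this.eventually (gt_mem_nhds hε)] with x hx
  rw [Real.dist_eq]
  exact (f.holder x a).trans_lt hx

instance : CompleteSpace (Hol E) := by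
  refine Metric.complete_of_cauchySeq_tendsto fun u hu => ?_
  have hp : ∀ x, CauchySeq fun n => u n x := by
    intro x
    rw [Metric.cauchySeq_iff] at hu ⊢
    intro ε hε
    obtain ⟨N, hN⟩ := hu ε hε
    refine ⟨N, fun m hm n hn => lt_of_le_of_lt ?_ (hN m hm n hn)⟩
    rw [Real.dist_eq, dist_eq_norm]
    exact (u m - u n).abs_le x
  choose g hg using fun x => cauchySeq_tendsto_of_complete (hp x)
  obtain ⟨C, hC⟩ := hu.norm_bddAbove
  have hC' : ∀ n, ‖u n‖ ≤ C := fun n => hC ⟨n, rfl⟩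
  have hmem : ∃ C : ℝ, (∀ x, |g x| ≤ C) ∧ ∀ x y, |g x - g y| ≤ C * √(dist x y) := by
    refine ⟨C, fun x => ?_, fun x y => ?_⟩
    · exact le_of_tendsto (hg x).abs (Filter.Eventually.of_forall fun n => ((u n).abs_le x).trans (hC' n))
    · exact le_of_tendsto ((hg x).sub (hg y)).abs (Filter.Eventually.of_forall fun n =>
        ((u n).holder x y).trans (mul_le_mul_of_nonneg_right (hC' n) (Real.sqrt_nonneg _)))
  refine ⟨Hol.mk g hmem, ?_⟩
  rw [Metric.tendsto_atTop]
  intro ε hε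
  obtain ⟨N, hN⟩ := Metric.cauchySeq_iff.1 hu (ε / 3) (by positivity)
  refine ⟨N, fun n hn => ?_⟩
  rw [dist_eq_norm]
  have hb : ∀ m ≥ N, ‖u n - u m‖ ≤ ε / 3 := fun m hm => by
    rw [← dist_eq_norm]; exact (hN n hn m hm).le
  refine lt_of_le_of_lt (Hol.norm_le (A := ε / 3) (B := ε / 3) (by positivity) (by positivity)
    (fun x => ?_) (fun x y => ?_)) (by linarith)
  · refine le_of_tendsto ((tendsto_const_nhds (x := u n x)).sub (hg x)).abs ?_
    filter_upwards [Filter.eventually_ge_atTop N] with m hm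
    exact ((u n - u m).abs_le x).trans (hb m hm)
  · refine le_of_tendsto (((tendsto_const_nhds (x := u n x)).sub (hg x)).sub
      ((tendsto_const_nhds (x := u n y)).sub (hg y))).abs ?_
    filter_upwards [Filter.eventually_ge_atTop N] with m hm
    exact ((u n - u m).holder x y).trans
      (mul_le_mul_of_nonneg_right (hb m hm) (Real.sqrt_nonneg _))

/-- evaluation -/
noncomputable def Hol.ev (x : E) : Hol E →L[ℝ] ℝ :=
  LinearMap.mkContinuous { toFun := fun f => f x, map_add' := fun _ _ => rfl, map_smul' := fun _ _ => rfl }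
    1 (fun f => by rw [one_mul]; exact f.abs_le x)

@[simp] theorem Hol.ev_apply (x : E) (f : Hol E) : Hol.ev x f = f x := rfl

theorem Hol.sum_apply {ι : Type*} (s : Finset ι) (f : ι → Hol E) (x : E) :
    (∑ i ∈ s, f i) x = ∑ i ∈ s, f i x := by
  exact map_sum (Hol.ev x) f s

/-- bounded Lipschitz functions, with interpolated norm bound -/
theorem lip_holder {f : E → ℝ} {σ L : ℝ} (h : ∀ x, |f x| ≤ σ)
    (h' : ∀ x y, |f x - f y| ≤ L * dist x y) (x y : E) :
    |f x - f y| ≤ √(2 * σ * L) * √(dist x y) := by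
  have hσ : 0 ≤ σ := (abs_nonneg _).trans (h x)
  have h1 : |f x - f y| ≤ 2 * σ := (abs_sub _ _).trans (by linarith [h x, h y])
  rw [← Real.sqrt_mul' _ dist_nonneg]
  apply Real.le_sqrt_of_sq_le
  have := h' x y
  nlinarith [abs_nonneg (f x - f y)]

theorem Hol.exists_of_lip (f : E → ℝ) {σ L : ℝ} (h0 : 0 ≤ σ) (h : ∀ x, |f x| ≤ σ)
    (h' : ∀ x y, |f x - f y| ≤ L * dist x y) :
    ∃ F : Hol E, (∀ x, F x = f x) ∧ ‖F‖ ≤ σ + √(2 * σ * L) := by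
  have key := lip_holder h h'
  refine ⟨Hol.mk f ⟨σ + √(2 * σ * L), fun x => ?_, fun x y => ?_⟩, fun x => rfl, ?_⟩
  · have := Real.sqrt_nonneg (2 * σ * L); linarith [h x]
  · refine (key x y).trans (mul_le_mul_of_nonneg_right ?_ (Real.sqrt_nonneg _)); linarith
  · exact Hol.norm_le h0 (Real.sqrt_nonneg _) h key

end
end RH
end


section
open Real Set MeasureTheory
namespace RH
set_option linter.unusedSectionVars false

section
variable {E : Type} [NormedAddCommGroup E] [NormedSpace ℝ E] [FiniteDimensional ℝ E]
  [MeasureSpace E] [BorelSpace E] [(volume : Measure E).IsAddHaarMeasure]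

/-- Admissible kernels: Lipschitz, bounded, supported in a ball, zero mean. -/
structure Ker (K : E → ℝ) (R B L : ℝ) : Prop where
  hR : 0 ≤ R
  hL : 0 ≤ L
  bdd : ∀ z, |K z| ≤ B
  lip : ∀ x y, |K x - K y| ≤ L * ‖x - y‖
  supp : ∀ z, R < ‖z‖ → K z = 0
  zero : ∫ z, K z = 0

theorem Ker.cont {K : E → ℝ} {R B L : ℝ} (h : Ker K R B L) : Continuous K := by
  have : LipschitzWith (Real.toNNReal L) K := LipschitzWith.of_dist_le_mul fun x y => by
    rw [Real.dist_eq, dist_eq_norm, Real.coe_toNNReal _ h.hL]; exact h.lip x y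
  exact this.continuous

theorem integrable_of_supp {f : E → ℝ} {R : ℝ} (hf : Continuous f)
    (hs : ∀ z, R < ‖z‖ → f z = 0) : Integrable f := by
  refine hf.integrable_of_hasCompactSupport ?_
  refine HasCompactSupport.intro (isCompact_closedBall (0 : E) R) fun x hx => hs x ?_
  simpa using hx

theorem integral_bound {f : E → ℝ} {R C : ℝ} 
    (hs : ∀ z, R < ‖z‖ → f z = 0) (hC : ∀ z, ‖z‖ ≤ R → |f z| ≤ C) :
    |∫ z, f z| ≤ C * (volume (Metric.closedBall (0 : E) R)).toReal := by
  have : ∫ z, f z = ∫ z in Metric.closedBall (0 : E) R, f z := by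
    rw [setIntegral_eq_integral_of_forall_compl_eq_zero]
    intro x hx; exact hs x (by simpa using hx)
  rw [this, ← Real.norm_eq_abs]
  refine norm_setIntegral_le_of_norm_le_const measure_closedBall_lt_top fun x hx => ?_
  exact hC x (by simpa using hx)

/-- inner operator -/
noncomputable def Mop (K : E → ℝ) (s : ℝ) (f : E → ℝ) (x : E) : ℝ := ∫ z, K z * f (x - s ^ 2 • z)

theorem Ker.integrable {K : E → ℝ} {R B L : ℝ} (h : Ker K R B L) {f : E → ℝ}
    (hf : Continuous f) : Integrable fun z => K z * f z := by
  have := h.cont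
  exact integrable_of_supp (R := R) (by fun_prop) fun z hz => by rw [h.supp z hz, zero_mul]

theorem Ker.M_bound {K : E → ℝ} {R B L : ℝ} (h : Ker K R B L) :
    ∃ C, 0 ≤ C ∧ ∀ (f : Hol E) (s : ℝ) (x : E), 0 ≤ s → |Mop K s f x| ≤ C * ‖f‖ * s := by
  have hB : 0 ≤ B := (abs_nonneg _).trans (h.bdd 0)
  refine ⟨B * √R * (volume (Metric.closedBall (0 : E) R)).toReal, by positivity, ?_⟩
  intro f s x hs
  have hf := f.continuous
  have e : Mop K s f x = ∫ z, K z * (f (x - s ^ 2 • z) - f x) := by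
    simp_rw [mul_sub]
    rw [integral_sub (h.integrable (by fun_prop)) (h.integrable (by fun_prop)),
      integral_mul_const, h.zero, zero_mul, sub_zero]
    rfl
  rw [e]
  refine (integral_bound (R := R) (C := B * (‖f‖ * (s * √R)))
    (fun z hz => by rw [h.supp z hz, zero_mul]) fun z hz => ?_).trans (le_of_eq (by ring))
  rw [abs_mul]
  refine mul_le_mul (h.bdd z) ((f.holder _ _).trans ?_) (abs_nonneg _) hB
  refine mul_le_mul_of_nonneg_left ?_ (norm_nonneg _)
  rw [dist_eq_norm, sub_sub_cancel_left, norm_neg, norm_smul, Real.sqrt_mul (norm_nonneg _)]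
  rw [norm_pow, Real.sqrt_sq (norm_nonneg _), Real.norm_of_nonneg hs]
  exact mul_le_mul_of_nonneg_left (Real.sqrt_le_sqrt hz) hs

theorem Ker.M_diff {K : E → ℝ} {R B L : ℝ} (h : Ker K R B L) :
    ∃ C, 0 ≤ C ∧ ∀ (f : Hol E) (s : ℝ) (x y : E), 0 < s → dist x y ≤ s ^ 2 →
      |Mop K s f x - Mop K s f y| ≤ C * ‖f‖ * (dist x y / s) := by
  have hL := h.hL
  refine ⟨L * √(R + 1) * (volume (Metric.closedBall (0 : E) (R + 1))).toReal, by positivity, ?_⟩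
  intro f s x y hs hd
  have hf := f.continuous
  have hK := h.cont
  set w : E := (s ^ 2)⁻¹ • (y - x) with hw
  have hwn : ‖w‖ = dist x y / s ^ 2 := by
    rw [hw, norm_smul, norm_inv, norm_pow, Real.norm_of_nonneg hs.le, dist_eq_norm', div_eq_inv_mul]
  have hw1 : ‖w‖ ≤ 1 := by rw [hwn]; exact div_le_one_of_le₀ hd (by positivity)
  have hKs : ∀ z, R + 1 < ‖z‖ → K (z + w) = 0 := fun z hz => h.supp _ (by
    have := norm_sub_norm_le z (-w)
    rw [sub_neg_eq_add, norm_neg] at this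
    linarith)
  have hKs' : ∀ z, R + 1 < ‖z‖ → K z = 0 := fun z hz => h.supp _ (by linarith)
  have ey : Mop K s f y = ∫ z, K (z + w) * f (x - s ^ 2 • z) := by
    rw [Mop, ← integral_add_right_eq_self _ w]
    congr 1; ext z; congr 2
    rw [smul_add, hw, smul_smul, mul_inv_cancel₀ (by positivity), one_smul]; abel
  have i1 : Integrable fun z => K z * f (x - s ^ 2 • z) := h.integrable (by fun_prop)
  have i2 : Integrable fun z => K (z + w) * f (x - s ^ 2 • z) :=
    integrable_of_supp (R := R + 1) (by fun_prop) fun z hz => by rw [hKs z hz, zero_mul]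
  have i3 : Integrable fun z => K z * f x := h.integrable (by fun_prop)
  have i4 : Integrable fun z => K (z + w) * f x :=
    integrable_of_supp (R := R + 1) (by fun_prop) fun z hz => by rw [hKs z hz, zero_mul]
  have e : Mop K s f x - Mop K s f y =
      ∫ z, (K z - K (z + w)) * (f (x - s ^ 2 • z) - f x) := by
    have : ∀ z, (K z - K (z + w)) * (f (x - s ^ 2 • z) - f x) =
      (K z * f (x - s ^ 2 • z) - K (z + w) * f (x - s ^ 2 • z)) - (K z * f x - K (z + w) * f x) :=
      fun z => by ring
    simp_rw [this]
    have e2 := integral_sub (i1.sub i2) (i3.sub i4)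
    simp only [Pi.sub_apply] at e2
    rw [e2, integral_sub i1 i2, integral_sub i3 i4,
      integral_mul_const, integral_mul_const, integral_add_right_eq_self K w, h.zero, ey, Mop]
    ring
  rw [e]
  refine (integral_bound (R := R + 1) (C := L * (dist x y / s ^ 2) * (‖f‖ * (s * √(R + 1))))
    (fun z hz => by rw [hKs z hz, hKs' z hz, sub_self, zero_mul]) fun z hz => ?_).trans
      (le_of_eq (by field_simp))
  rw [abs_mul]
  refine mul_le_mul ((h.lip _ _).trans ?_) ((f.holder _ _).trans ?_) (abs_nonneg _) (by positivity)
  · rw [sub_add_cancel_left, norm_neg, hwn]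
  refine mul_le_mul_of_nonneg_left ?_ (norm_nonneg _)
  rw [dist_eq_norm, sub_sub_cancel_left, norm_neg, norm_smul, Real.sqrt_mul (norm_nonneg _)]
  rw [norm_pow, Real.sqrt_sq (norm_nonneg _), Real.norm_of_nonneg hs.le]
  exact mul_le_mul_of_nonneg_left (Real.sqrt_le_sqrt hz) hs.le

theorem Ker.M_cont {K : E → ℝ} {R B L : ℝ} (h : Ker K R B L) {f : E → ℝ}
    (hf : Continuous f) (x : E) : Continuous fun s => Mop K s f x := by
  have hK := h.cont
  have e : ∀ s, Mop K s f x = ∫ z in Metric.closedBall (0 : E) R, K z * f (x - s ^ 2 • z) := by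
    intro s
    rw [Mop, setIntegral_eq_integral_of_forall_compl_eq_zero]
    intro z hz; rw [h.supp z (by simpa using hz), zero_mul]
  simp_rw [e]
  exact continuous_parametric_integral_of_continuous (by fun_prop) (isCompact_closedBall _ _)

theorem arctan_int {d S : ℝ} (hd : 0 < d) (hS : 0 ≤ S) :
    ∫ s in (0 : ℝ)..S, d / (d + s ^ 2) ≤ √d * (π / 2) := by
  have hD : 0 < √d := Real.sqrt_pos.2 hd
  have e : ∀ s : ℝ, d / (d + s ^ 2) = (fun t : ℝ => 1 / (1 + t ^ 2)) (s / √d) := by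
    intro s
    have : (√d) ^ 2 = d := Real.sq_sqrt hd.le
    simp only [div_pow, this]
    field_simp
  rw [intervalIntegral.integral_congr (fun s _ => e s),
    intervalIntegral.integral_comp_div (fun t : ℝ => 1 / (1 + t ^ 2)) hD.ne', integral_one_div_one_add_sq]
  simp only [zero_div, arctan_zero, sub_zero, smul_eq_mul]
  exact mul_le_mul_of_nonneg_left (arctan_lt_pi_div_two _).le hD.le

theorem Ker.J_intble {K : E → ℝ} {R B L : ℝ} (h : Ker K R B L) (S : ℝ) (hS : 0 ≤ S) (f : Hol E)
    (x : E) : IntervalIntegrable (fun s => 2 / s * Mop K s f x) volume 0 S := by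
  obtain ⟨C, hC, hb⟩ := h.M_bound
  rw [intervalIntegrable_iff_integrableOn_Ioc_of_le hS]
  refine Measure.integrableOn_of_bounded (M := 2 * (C * ‖f‖)) (by simp) ?_ ?_
  · exact ((measurable_const.div measurable_id).mul (h.M_cont f.continuous x).measurable).aestronglyMeasurable
  · refine (ae_restrict_iff' measurableSet_Ioc).2 (Filter.Eventually.of_forall fun s hs => ?_)
    have hs0 : 0 < s := hs.1
    rw [norm_mul, Real.norm_of_nonneg (by positivity), Real.norm_eq_abs]
    calc 2 / s * |Mop K s f x| ≤ 2 / s * (C * ‖f‖ * s) := by gcongr; exact hb f s x hs0.le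
      _ = _ := by field_simp

/-- The singular integral operator on the Hölder algebra. -/
theorem Ker.exists_J {K : E → ℝ} {R B L : ℝ} (h : Ker K R B L) (S : ℝ) (hS : 0 ≤ S) :
    ∃ J : Hol E →L[ℝ] Hol E, ∀ f x, J f x = ∫ s in (0 : ℝ)..S, 2 / s * Mop K s f x := by
  obtain ⟨C, hC, hb⟩ := h.M_bound
  obtain ⟨D, hD, hd⟩ := h.M_diff
  have hI := h.J_intble S hS
  have b1 : ∀ (f : Hol E) x, |∫ s in (0 : ℝ)..S, 2 / s * Mop K s f x| ≤ 2 * C * S * ‖f‖ := by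
    intro f x
    have := intervalIntegral.norm_integral_le_of_norm_le_const (a := 0) (b := S)
      (f := fun s => 2 / s * Mop K s f x) (C := 2 * (C * ‖f‖)) (fun s hs => by
        rw [uIoc_of_le hS] at hs
        have hs0 : 0 < s := hs.1
        rw [norm_mul, Real.norm_of_nonneg (by positivity), Real.norm_eq_abs]
        calc 2 / s * |Mop K s f x| ≤ 2 / s * (C * ‖f‖ * s) := by gcongr; exact hb f s x hs0.le
          _ = _ := by field_simp)
    rw [sub_zero, abs_of_nonneg hS] at this
    exact this.trans (le_of_eq (by ring))
  have b2 : ∀ (f : Hol E) x y, |(∫ s in (0 : ℝ)..S, 2 / s * Mop K s f x) -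
      ∫ s in (0 : ℝ)..S, 2 / s * Mop K s f y| ≤ (8 * C + 4 * D) * (π / 2) * ‖f‖ * √(dist x y) := by
    intro f x y
    rcases eq_or_ne x y with rfl | hxy
    · simp
    have hp : 0 < dist x y := dist_pos.2 hxy
    rw [← intervalIntegral.integral_sub (hI f x) (hI f y)]
    have hg : ContinuousOn (fun s : ℝ => (8 * C + 4 * D) * ‖f‖ * (dist x y / (dist x y + s ^ 2))) (uIcc 0 S) := by
      apply Continuous.continuousOn
      refine continuous_const.mul (continuous_const.div (by fun_prop) fun s => ?_)
      positivity
    have := intervalIntegral.norm_integral_le_of_norm_le (a := 0) (b := S) (μ := volume)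
      (f := fun s => 2 / s * Mop K s f x - 2 / s * Mop K s f y)
      (g := fun s => (8 * C + 4 * D) * ‖f‖ * (dist x y / (dist x y + s ^ 2))) hS
      (Filter.Eventually.of_forall fun s hs => by
        have hs0 : 0 < s := hs.1
        rw [← mul_sub, norm_mul, Real.norm_of_nonneg (by positivity), Real.norm_eq_abs]
        set d := dist x y
        rcases le_total (s ^ 2) d with hle | hle
        · have h1 : |Mop K s f x - Mop K s f y| ≤ 2 * (C * ‖f‖ * s) :=
            (abs_sub _ _).trans (by linarith [hb f s x hs0.le, hb f s y hs0.le])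
          have h2 : (1 : ℝ) / 2 ≤ d / (d + s ^ 2) := by
            rw [div_le_div_iff₀ (by norm_num) (by positivity)]; linarith
          calc 2 / s * |Mop K s f x - Mop K s f y| ≤ 2 / s * (2 * (C * ‖f‖ * s)) := by gcongr
            _ = 8 * C * ‖f‖ * (1 / 2) := by field_simp; ring
            _ ≤ (8 * C + 4 * D) * ‖f‖ * (d / (d + s ^ 2)) := by gcongr; linarith
        · have h2 : d / s ^ 2 ≤ 2 * (d / (d + s ^ 2)) := by
            rw [← mul_div_assoc, div_le_div_iff₀ (by positivity) (by positivity)]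
            nlinarith
          calc 2 / s * |Mop K s f x - Mop K s f y| ≤ 2 / s * (D * ‖f‖ * (d / s)) := by
                gcongr; exact hd f s x y hs0 hle
            _ = 2 * D * ‖f‖ * (d / s ^ 2) := by field_simp
            _ ≤ 2 * D * ‖f‖ * (2 * (d / (d + s ^ 2))) := by gcongr
            _ = 4 * D * ‖f‖ * (d / (d + s ^ 2)) := by ring
            _ ≤ (8 * C + 4 * D) * ‖f‖ * (d / (d + s ^ 2)) := by gcongr; linarith)
      hg.intervalIntegrable
    rw [Real.norm_eq_abs, intervalIntegral.integral_const_mul] at this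
    refine this.trans ?_
    calc _ ≤ (8 * C + 4 * D) * ‖f‖ * (√(dist x y) * (π / 2)) := by
          gcongr; exact arctan_int hp hS
      _ = _ := by ring
  have hπ := Real.pi_pos
  set A := 2 * C * S with hA
  set A' := (8 * C + 4 * D) * (π / 2) with hA'
  have hA0 : 0 ≤ A := by positivity
  have hA0' : 0 ≤ A' := by positivity
  refine ⟨LinearMap.mkContinuous
    { toFun := fun f : Hol E => Hol.mk (fun x => ∫ s in (0 : ℝ)..S, 2 / s * Mop K s f x)
        ⟨A * ‖f‖ + A' * ‖f‖, fun x => (b1 f x).trans (le_add_of_nonneg_right (mul_nonneg hA0' (norm_nonneg _))),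
          fun x y => (b2 f x y).trans (mul_le_mul_of_nonneg_right
            (le_add_of_nonneg_left (mul_nonneg hA0 (norm_nonneg _))) (Real.sqrt_nonneg _))⟩
      map_add' := ?_
      map_smul' := ?_ } (A + A') ?_, fun f x => rfl⟩
  · intro f g
    ext x
    have hf := f.continuous
    have hg := g.continuous
    simp only [Hol.mk_apply, Hol.add_apply]
    rw [← intervalIntegral.integral_add (hI f x) (hI g x)]
    congr 1; ext s
    rw [← mul_add, Mop, Mop, Mop, ← integral_add (h.integrable (by fun_prop)) (h.integrable (by fun_prop))]
    simp_rw [← mul_add]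
    rfl
  · intro c f
    ext x
    simp only [Hol.mk_apply, Hol.smul_apply, RingHom.id_apply]
    rw [← intervalIntegral.integral_const_mul]
    congr 1; ext s
    rw [mul_left_comm, Mop, Mop, ← integral_const_mul c]
    congr 2; ext z
    rw [Hol.smul_apply]; ring
  · intro f
    refine le_trans (Hol.norm_le (A := A * ‖f‖) (B := A' * ‖f‖) (by positivity) (by positivity)
      ?_ ?_) (le_of_eq (by ring))
    · exact fun x => b1 f x
    · exact fun x y => b2 f x y

/-- Averaging along a segment. -/
theorem exists_avg (e : E) : ∃ I : Hol E →L[ℝ] Hol E, ∀ f x,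
    I f x = ∫ t in (0 : ℝ)..4, f (x + t • e) := by
  have hc : ∀ (f : Hol E) x, Continuous fun t : ℝ => f (x + t • e) := fun f x => by
    have := f.continuous; fun_prop
  have b1 : ∀ (f : Hol E) x, |∫ t in (0 : ℝ)..4, f (x + t • e)| ≤ 4 * ‖f‖ := by
    intro f x
    have := intervalIntegral.norm_integral_le_of_norm_le_const (a := 0) (b := 4)
      (f := fun t : ℝ => f (x + t • e)) (C := ‖f‖) (fun t _ => f.abs_le _)
    rw [Real.norm_eq_abs] at this
    refine this.trans (le_of_eq ?_)
    norm_num; ring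
  have b2 : ∀ (f : Hol E) x y, |(∫ t in (0 : ℝ)..4, f (x + t • e)) -
      ∫ t in (0 : ℝ)..4, f (y + t • e)| ≤ 4 * ‖f‖ * √(dist x y) := by
    intro f x y
    rw [← intervalIntegral.integral_sub ((hc f x).intervalIntegrable _ _) ((hc f y).intervalIntegrable _ _)]
    have := intervalIntegral.norm_integral_le_of_norm_le_const (a := 0) (b := 4)
      (f := fun t : ℝ => f (x + t • e) - f (y + t • e)) (C := ‖f‖ * √(dist x y)) (fun t _ => by
        have := f.holder (x + t • e) (y + t • e)
        rwa [dist_add_right] at this)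
    rw [Real.norm_eq_abs] at this
    refine this.trans (le_of_eq ?_)
    norm_num; ring
  refine ⟨LinearMap.mkContinuous
    { toFun := fun f : Hol E => Hol.mk (fun x => ∫ t in (0 : ℝ)..4, f (x + t • e))
        ⟨4 * ‖f‖, b1 f, b2 f⟩
      map_add' := ?_
      map_smul' := ?_ } (4 + 4) ?_, fun f x => rfl⟩
  · intro f g
    ext x
    simp only [Hol.mk_apply, Hol.add_apply]
    rw [← intervalIntegral.integral_add ((hc f x).intervalIntegrable _ _) ((hc g x).intervalIntegrable _ _)]
  · intro c f
    ext x
    simp only [Hol.mk_apply, Hol.smul_apply, RingHom.id_apply]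
    rw [← intervalIntegral.integral_const_mul]
  · intro f
    refine le_trans (Hol.norm_le (A := 4 * ‖f‖) (B := 4 * ‖f‖) (by positivity) (by positivity)
      ?_ ?_) (le_of_eq (by ring))
    · exact fun x => b1 f x
    · exact fun x y => b2 f x y

end
end RH
end


section
open Real Set MeasureTheory
namespace RH
set_option linter.unusedSectionVars false
section
variable {n : ℕ}
local notation "𝔼" => EuclideanSpace ℝ (Fin n)

theorem fderiv_eq_sum (f : 𝔼 → ℝ) (x v : 𝔼) :
    fderiv ℝ f x v = ∑ i, v i * pd f i x := by
  have : v = ∑ i, v i • (EuclideanSpace.single i (1 : ℝ) : 𝔼) := by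
    ext j
    simp [Finset.sum_apply, Pi.single_apply]
  conv_lhs => rw [this]
  simp [pd, map_sum]

theorem pd_sum {ι : Type*} (s : Finset ι) (F : ι → 𝔼 → ℝ) {y : 𝔼} {k : Fin n}
    (hF : ∀ i ∈ s, DifferentiableAt ℝ (F i) y) :
    pd (fun y => ∑ i ∈ s, F i y) k y = ∑ i ∈ s, pd (F i) k y := by
  unfold pd
  rw [fderiv_fun_sum hF]
  simp

theorem pd_const_mul (c : ℝ) {f : 𝔼 → ℝ} {y : 𝔼} (hf : DifferentiableAt ℝ f y) (k : Fin n) :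
    pd (fun y => c * f y) k y = c * pd f k y := by
  unfold pd
  rw [fderiv_const_mul hf]; simp

theorem pd_mul {f g : 𝔼 → ℝ} {y : 𝔼} (hf : DifferentiableAt ℝ f y) (hg : DifferentiableAt ℝ g y)
    (k : Fin n) : pd (fun y => f y * g y) k y = f y * pd g k y + g y * pd f k y := by
  unfold pd
  rw [fderiv_fun_mul hf hg]; simp

theorem pd_add {f g : 𝔼 → ℝ} {y : 𝔼} (hf : DifferentiableAt ℝ f y) (hg : DifferentiableAt ℝ g y)
    (k : Fin n) : pd (fun y => f y + g y) k y = pd f k y + pd g k y := by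
  unfold pd
  rw [fderiv_fun_add hf hg]; simp

theorem pd_sub {f g : 𝔼 → ℝ} {y : 𝔼} (hf : DifferentiableAt ℝ f y) (hg : DifferentiableAt ℝ g y)
    (k : Fin n) : pd (fun y => f y - g y) k y = pd f k y - pd g k y := by
  unfold pd
  rw [fderiv_fun_sub hf hg]; simp

theorem pd_const (c : ℝ) (k : Fin n) (y : 𝔼) : pd (fun _ => c) k y = 0 := by
  unfold pd; simp

theorem pd_congr {f g : 𝔼 → ℝ} {y : 𝔼} (h : f =ᶠ[nhds y] g) (k : Fin n) : pd f k y = pd g k y := by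
  unfold pd; rw [h.fderiv_eq]

theorem contDiff_pd {f : 𝔼 → ℝ} {k l : WithTop ℕ∞} (hf : ContDiff ℝ k f) (h : l + 1 ≤ k) (i : Fin n) :
    ContDiff ℝ l (pd f i) := by
  unfold pd
  exact (hf.fderiv_right h).clm_apply contDiff_const

theorem pd_comm {f : 𝔼 → ℝ} (hf : ContDiff ℝ 2 f) (i j : Fin n) (x : 𝔼) :
    pd (pd f i) j x = pd (pd f j) i x := by
  have hs : IsSymmSndFDerivAt ℝ f x := hf.contDiffAt.isSymmSndFDerivAt (by simp)
  have hd : DifferentiableAt ℝ (fderiv ℝ f) x :=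
    ((hf.fderiv_right (m := 1) (by norm_num)).differentiable (by norm_num)) x
  have e : ∀ i j : Fin n, pd (pd f i) j x =
      fderiv ℝ (fderiv ℝ f) x (EuclideanSpace.single j 1) (EuclideanSpace.single i 1) := by
    intro i j
    unfold pd
    rw [fderiv_clm_apply hd (by fun_prop)]
    simp
  rw [e, e, hs]

theorem hasCompactSupport_pd {f : 𝔼 → ℝ} (hf : HasCompactSupport f) (i : Fin n) :
    HasCompactSupport (pd f i) := hf.fderiv_apply (𝕜 := ℝ) _

theorem pd_comp_scale {f : 𝔼 → ℝ} (hf : Differentiable ℝ f) (x : 𝔼) (c : ℝ) (k : Fin n) (z : 𝔼) :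
    pd (fun z => f (x - c • z)) k z = -(c * pd f k (x - c • z)) := by
  have h1 : HasFDerivAt (fun z : 𝔼 => x - c • z) (-(c • ContinuousLinearMap.id ℝ 𝔼)) z := by
    have := ((hasFDerivAt_id (𝕜 := ℝ) z).const_smul c).const_sub x
    exact this
  have h2 := (hf (x - c • z)).hasFDerivAt.comp z h1
  have h3 : fderiv ℝ (fun z => f (x - c • z)) z = _ := h2.fderiv
  unfold pd
  rw [h3]
  simp

theorem ibp {W f : 𝔼 → ℝ} (hW : ContDiff ℝ 1 W) (hc : HasCompactSupport W) (hf : ContDiff ℝ 1 f)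
    (s : ℝ) (k : Fin n) (x : 𝔼) :
    s ^ 2 * ∫ z, W z * pd f k (x - s ^ 2 • z) = Mop (pd W k) s f x := by
  have hfd := hf.differentiable (by norm_num)
  have hWd := hW.differentiable (by norm_num)
  have c1 := (contDiff_pd hf (l := 0) (by norm_num) k).continuous
  have c2 := (contDiff_pd hW (l := 0) (by norm_num) k).continuous
  have c3 := hf.continuous
  have c4 := hW.continuous
  have key := integral_mul_fderiv_eq_neg_fderiv_mul_of_integrable (μ := (volume : Measure 𝔼)) (𝕜 := ℝ)
    (f := W) (g := fun z => f (x - s ^ 2 • z)) (v := EuclideanSpace.single k 1) ?_ ?_ ?_ ?_ ?_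
  · change ∫ z, W z * pd (fun z => f (x - s ^ 2 • z)) k z = - ∫ z, pd W k z * f (x - s ^ 2 • z) at key
    simp_rw [pd_comp_scale hfd] at key
    rw [Mop, ← neg_eq_iff_eq_neg.2 key, ← integral_neg, ← integral_const_mul]
    congr 1; ext z; ring
  · exact Continuous.integrable_of_hasCompactSupport (f := fun z => pd W k z * f (x - s ^ 2 • z)) (by fun_prop)
      (hasCompactSupport_pd hc k).mul_right
  · change Integrable fun z => W z * pd (fun z => f (x - s ^ 2 • z)) k z
    simp_rw [pd_comp_scale hfd]
    exact Continuous.integrable_of_hasCompactSupport (by fun_prop) hc.mul_right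
  · exact Continuous.integrable_of_hasCompactSupport (by fun_prop) hc.mul_right
  · exact fun z _ => hWd z
  · fun_prop

theorem divfree_zero {m : 𝔼 → ℝ} (hm : ContDiff ℝ 3 m) (hc : HasCompactSupport m)
    {G : Fin n → 𝔼 → ℝ} (hG : ∀ j, ContDiff ℝ 1 (G j)) (hdiv : ∀ x, ∑ j, pd (G j) j x = 0)
    (s : ℝ) (k : Fin n) (x : 𝔼) : ∑ j, Mop (pd (pd m j) k) s (G j) x = 0 := by
  have hmk : ContDiff ℝ 1 (pd m k) := contDiff_pd hm (by norm_num) k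
  have e : ∀ j, Mop (pd (pd m j) k) s (G j) x =
      s ^ 2 * ∫ z, pd m k z * pd (G j) j (x - s ^ 2 • z) := by
    intro j
    rw [ibp hmk (hasCompactSupport_pd hc k) (hG j)]
    congr 1; ext z; exact pd_comm (hm.of_le (by norm_num)) j k z
  have c1 := hmk.continuous
  have c2 := fun j => (contDiff_pd (hG j) (l := 0) (by norm_num) j).continuous
  simp_rw [e]
  rw [← Finset.mul_sum, ← integral_finsetSum]
  · simp_rw [← Finset.mul_sum, hdiv]; simp
  · intro j _
    have := c2 j
    exact Continuous.integrable_of_hasCompactSupport (by fun_prop) (hasCompactSupport_pd hc k).mul_right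

theorem repro {m ρ h : 𝔼 → ℝ} {a : Fin n → Fin n → ℝ} {c₀ S : ℝ}
    (hm : ContDiff ℝ 3 m) (hc : HasCompactSupport m)
    (hρ : Continuous ρ) (hρc : HasCompactSupport ρ)
    (hρm : ∀ z i, ρ z * z i = ∑ j, a i j * pd m j z) (hρ0 : ∀ z, ‖z‖ < c₀ → ρ z = 0)
    (hS : 0 ≤ S) (hSc : 3 < S ^ 2 * c₀) (hh : ContDiff ℝ 2 h) (hh0 : ∀ x, 1 < ‖x‖ → h x = 0)
    (k : Fin n) (x : 𝔼) (hx : ‖x‖ ≤ 2) :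
    (∫ z, ρ z) * pd h k x =
      ∫ s in (0 : ℝ)..S, 2 / s * ∑ j, Mop (pd (pd m j) k) s (fun y => ∑ i, a i j * pd h i y) x := by
  set f := pd h k with hf
  have hfC : ContDiff ℝ 1 f := contDiff_pd hh (by norm_num) k
  have hfd := hfC.differentiable (by norm_num)
  have hfD : Continuous (fderiv ℝ f) := hfC.continuous_fderiv (by norm_num)
  have hfcont := hfC.continuous
  -- pointwise FTC
  have ftc : ∀ z : 𝔼, ∫ s in (0 : ℝ)..S, 2 * s * fderiv ℝ f (x - s ^ 2 • z) z
      = f x - f (x - S ^ 2 • z) := by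
    intro z
    have hd : ∀ s : ℝ, HasDerivAt (fun s : ℝ => -f (x - s ^ 2 • z))
        (2 * s * fderiv ℝ f (x - s ^ 2 • z) z) s := by
      intro s
      have h1 : HasDerivAt (fun s : ℝ => x - s ^ 2 • z) (-((2 * s) • z)) s := by
        have := ((hasDerivAt_pow 2 s).smul_const z).const_sub x
        simpa using this
      have h2 := ((hfd (x - s ^ 2 • z)).hasFDerivAt.comp_hasDerivAt s h1).neg
      simp only [map_neg, map_smul, smul_eq_mul, neg_neg] at h2
      exact h2
    rw [intervalIntegral.integral_eq_sub_of_hasDerivAt (fun s _ => hd s)]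
    · simp; ring
    · apply Continuous.intervalIntegrable
      fun_prop
  have hfar : ∀ z, ρ z * f (x - S ^ 2 • z) = 0 := by
    intro z
    by_cases hz : ‖z‖ < c₀
    · rw [hρ0 z hz, zero_mul]
    · push Not at hz
      have h1 : 1 < ‖x - S ^ 2 • z‖ := by
        have h2 := norm_sub_norm_le (S ^ 2 • z) x
        rw [norm_sub_rev, norm_smul, Real.norm_of_nonneg (by positivity)] at h2
        have : S ^ 2 * c₀ ≤ S ^ 2 * ‖z‖ := by gcongr
        linarith
      have h3 : h =ᶠ[nhds (x - S ^ 2 • z)] fun _ => 0 := by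
        filter_upwards [(isOpen_lt continuous_const continuous_norm).mem_nhds h1] with y hy
        exact hh0 y hy
      have : f (x - S ^ 2 • z) = 0 := by
        rw [hf, pd, h3.fderiv_eq]; simp
      rw [this, mul_zero]
  have L1 : (∫ z, ρ z) * f x = ∫ z, ∫ s in (0 : ℝ)..S, ρ z * (2 * s * fderiv ℝ f (x - s ^ 2 • z) z) := by
    rw [← integral_mul_const]
    congr 1; ext z
    rw [intervalIntegral.integral_const_mul, ftc, mul_sub, hfar, sub_zero]
  rw [L1]
  -- Fubini
  have hsupp : tsupport ρ ⊆ tsupport ρ := le_rfl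
  have fub : ∫ z, ∫ s in (0 : ℝ)..S, ρ z * (2 * s * fderiv ℝ f (x - s ^ 2 • z) z) =
      ∫ s in (0 : ℝ)..S, ∫ z, ρ z * (2 * s * fderiv ℝ f (x - s ^ 2 • z) z) := by
    simp_rw [intervalIntegral.integral_of_le hS]
    rw [integral_integral_swap]
    set F : 𝔼 × ℝ → ℝ := fun p => ρ p.1 * (2 * p.2 * fderiv ℝ f (x - p.2 ^ 2 • p.1) p.1) with hF
    have hFc : Continuous F := by fun_prop
    change Integrable F _
    rw [← Measure.restrict_univ (μ := (volume : Measure 𝔼)), Measure.prod_restrict]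
    have hK : IsCompact (tsupport ρ ×ˢ Icc (0 : ℝ) S) := hρc.isCompact.prod isCompact_Icc
    have h1 : IntegrableOn F (tsupport ρ ×ˢ Icc (0 : ℝ) S) (volume.prod volume) :=
      hFc.continuousOn.integrableOn_compact hK
    have h2 : IntegrableOn F (tsupport ρ ×ˢ Ioc (0 : ℝ) S) (volume.prod volume) :=
      h1.mono_set (Set.prod_mono le_rfl Ioc_subset_Icc_self)
    refine h2.of_forall_sdiff_eq_zero (MeasurableSet.univ.prod measurableSet_Ioc) ?_
    rintro ⟨z, s⟩ hp
    have : z ∉ tsupport ρ := fun hz => hp.2 ⟨hz, hp.1.2⟩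
    simp only [hF]
    rw [image_eq_zero_of_notMem_tsupport this, zero_mul]
  rw [fub]
  congr 1; ext s
  rcases eq_or_ne s 0 with rfl | hs
  · simp
  have cpd : ∀ i, ContDiff ℝ 1 (pd h i) := fun i => contDiff_pd hh (by norm_num) i
  have hmj : ∀ j, ContDiff ℝ 1 (pd m j) := fun j => contDiff_pd hm (by norm_num) j
  have hmj' := fun j => (hmj j).continuous
  have c2 : ∀ i, Continuous (pd (pd h i) k) := fun i => (contDiff_pd (cpd i) (l := 0) (by norm_num) k).continuous
  have hagC : ∀ j, ContDiff ℝ 1 fun y => ∑ i, a i j * pd h i y := fun j =>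
    ContDiff.sum fun i _ => contDiff_const.mul (cpd i)
  have e1 : ∀ z, ρ z * (2 * s * fderiv ℝ f (x - s ^ 2 • z) z) =
      ∑ j, 2 * s * (pd m j z * pd (fun y => ∑ i, a i j * pd h i y) k (x - s ^ 2 • z)) := by
    intro z
    have e2 : ∀ j y, pd (fun y => ∑ i, a i j * pd h i y) k y = ∑ i, a i j * pd (pd h i) k y := by
      intro j y
      have hd : ∀ i, DifferentiableAt ℝ (pd h i) y := fun i => (cpd i).differentiable (by norm_num) y
      rw [pd_sum _ _ fun i _ => (hd i).const_mul _]
      exact Finset.sum_congr rfl fun i _ => pd_const_mul _ (hd i) k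
    simp_rw [e2]
    rw [fderiv_eq_sum]
    calc ρ z * (2 * s * ∑ i, z i * pd f i (x - s ^ 2 • z))
        = ∑ i, 2 * s * ((ρ z * z i) * pd f i (x - s ^ 2 • z)) := by
          rw [Finset.mul_sum, Finset.mul_sum]; exact Finset.sum_congr rfl fun i _ => by ring
      _ = ∑ i, ∑ j, 2 * s * (a i j * pd m j z * pd (pd h i) k (x - s ^ 2 • z)) := by
          refine Finset.sum_congr rfl fun i _ => ?_
          rw [hρm, Finset.sum_mul, Finset.mul_sum, hf, pd_comm hh k i]
      _ = _ := by
          rw [Finset.sum_comm]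
          refine Finset.sum_congr rfl fun j _ => ?_
          rw [Finset.mul_sum, Finset.mul_sum]
          exact Finset.sum_congr rfl fun i _ => by ring
  simp_rw [e1]
  rw [integral_finsetSum, Finset.mul_sum]
  · refine Finset.sum_congr rfl fun j _ => ?_
    rw [integral_const_mul, ← ibp (hmj j) (hasCompactSupport_pd hc j) (hagC j)]
    field_simp
  · intro j _
    have c3 := (contDiff_pd (hagC j) (l := 0) (by norm_num) k).continuous
    have c4 := hmj' j
    exact (Continuous.integrable_of_hasCompactSupport (by fun_prop) (hasCompactSupport_pd hc j).mul_right).const_mul _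

end
end RH
end


section
open Real Set MeasureTheory
namespace RH
section
variable {n : ℕ}
local notation "𝔼" => EuclideanSpace ℝ (Fin n)

theorem ker_pd {W : 𝔼 → ℝ} (hW : ContDiff ℝ 2 W) (hc : HasCompactSupport W) (k : Fin n) :
    ∃ R B L, Ker (pd W k) R B L := by
  have h1 : ContDiff ℝ 1 (pd W k) := contDiff_pd hW (by norm_num) k
  have h2 : HasCompactSupport (pd W k) := hasCompactSupport_pd hc k
  obtain ⟨C, hC⟩ := h1.lipschitzWith_of_hasCompactSupport h2 (by norm_num)
  obtain ⟨B, hB⟩ := h2.exists_bound_of_continuous h1.continuous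
  obtain ⟨R, hR⟩ := h2.isCompact.isBounded.subset_closedBall (0 : 𝔼)
  refine ⟨max R 0, B, C, ⟨le_max_right _ _, C.2, hB, fun x y => ?_, fun z hz => ?_, ?_⟩⟩
  · have := hC.dist_le_mul x y
    rwa [Real.dist_eq, dist_eq_norm] at this
  · apply image_eq_zero_of_notMem_tsupport
    intro hz'
    have := hR hz'
    simp at this
    have := (le_max_left R 0)
    linarith
  · have := ibp (hW.of_le (by norm_num)) hc (contDiff_const (c := (1 : ℝ))) 1 k 0
    simp only [pd_const, Mop] at this
    simpa using this.symm

theorem kernel_exists (i₀ : Fin n) {z₀ s₀ : ℝ} (hz : 0 < z₀) (hs : 0 < s₀) (p : Fin n → ℝ)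
    (hsz : s₀ ^ 2 = z₀ ^ 2 + ∑ i, p i ^ 2) (a : Fin n → Fin n → ℝ)
    (ha : ∀ i j, a i j = z₀ / s₀ * ((if i = j then 1 else 0) - p i * p j / s₀ ^ 2)) :
    ∃ (m ρ : 𝔼 → ℝ) (c₀ : ℝ), 0 < c₀ ∧ ContDiff ℝ 3 m ∧ HasCompactSupport m ∧ Continuous ρ ∧
      HasCompactSupport ρ ∧ (∀ z i, ρ z * z i = ∑ j, a i j * pd m j z) ∧
      (∀ z, ‖z‖ < c₀ → ρ z = 0) ∧ ∫ z, ρ z ≠ 0 := by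
  set q : 𝔼 → ℝ := fun z => s₀ / z₀ * (∑ i, z i ^ 2 + (∑ i, p i * z i) ^ 2 / z₀ ^ 2) with hq
  set M : ℝ → ℝ := fun t => smoothTransition (t - 1) with hM
  have hMC : ContDiff ℝ 4 M := smoothTransition.contDiff.comp (by fun_prop)
  have hMd : Differentiable ℝ M := hMC.differentiable (by norm_num)
  have hM' : Continuous (deriv M) := hMC.continuous_deriv (by norm_num)
  have hqC : ContDiff ℝ 4 q := by
    have : ∀ i : Fin n, ContDiff ℝ 4 fun z : 𝔼 => z i := fun i => contDiff_piLp_apply 2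
    rw [hq]
    refine contDiff_const.mul ((ContDiff.sum fun i _ => (this i).pow 2).add
      (((ContDiff.sum fun i _ => contDiff_const.mul (this i)).pow 2).div_const _))
  have hcoord : ∀ (i j : Fin n) (z : 𝔼), pd (fun z : 𝔼 => z i) j z = if i = j then 1 else 0 := by
    intro i j z
    have : HasFDerivAt (fun z : 𝔼 => z i) (EuclideanSpace.proj i : 𝔼 →L[ℝ] ℝ) z :=
      (EuclideanSpace.proj i : 𝔼 →L[ℝ] ℝ).hasFDerivAt
    rw [pd, this.fderiv]
    simp
  have hcd : ∀ (i : Fin n) (z : 𝔼), DifferentiableAt ℝ (fun z : 𝔼 => z i) z := fun i z =>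
    (EuclideanSpace.proj i : 𝔼 →L[ℝ] ℝ).differentiableAt
  have hlin : ∀ z j, pd (fun z : 𝔼 => ∑ i, p i * z i) j z = p j := by
    intro z j
    rw [pd_sum _ _ fun i _ => (hcd i z).const_mul _]
    simp_rw [pd_const_mul _ (hcd _ z), hcoord]
    simp
  have hlind : ∀ z, DifferentiableAt ℝ (fun z : 𝔼 => ∑ i, p i * z i) z := fun z =>
    DifferentiableAt.fun_sum fun i _ => (hcd i z).const_mul _
  have hpdq : ∀ z j, pd q j z = s₀ / z₀ * (2 * z j + 2 * (∑ i, p i * z i) * p j / z₀ ^ 2) := by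
    intro z j
    have e : q = fun z => s₀ / z₀ * (∑ i, z i * z i + (z₀ ^ 2)⁻¹ * ((∑ i, p i * z i) * (∑ i, p i * z i))) := by
      rw [hq]; ext z; simp only [sq, div_eq_inv_mul]
    have d1 : DifferentiableAt ℝ (fun z : 𝔼 => ∑ i, z i * z i) z :=
      DifferentiableAt.fun_sum fun i _ => (hcd i z).mul (hcd i z)
    have d2 : DifferentiableAt ℝ (fun z : 𝔼 => (∑ i, p i * z i) * (∑ i, p i * z i)) z := (hlind z).mul (hlind z)
    rw [e, pd_const_mul _ (DifferentiableAt.fun_add d1 (d2.const_mul _)), pd_add d1 (d2.const_mul _), pd_const_mul _ d2,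
      pd_mul (hlind z) (hlind z), hlin, pd_sum Finset.univ (fun i (z : 𝔼) => z i * z i) fun i _ => (hcd i z).mul (hcd i z)]
    simp_rw [pd_mul (hcd _ z) (hcd _ z), hcoord]
    simp only [mul_ite, mul_one, mul_zero, ← two_mul]
    simp only [Finset.sum_ite_eq', Finset.mem_univ, if_true]
    ring
  have hqn : ∀ z, ‖z‖ ^ 2 ≤ q z := by
    intro z
    have h1 : 1 ≤ s₀ / z₀ := by
      rw [one_le_div hz]
      have : 0 ≤ ∑ i, p i ^ 2 := Finset.sum_nonneg fun i _ => sq_nonneg _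
      nlinarith
    rw [EuclideanSpace.real_norm_sq_eq]
    have h2 : 0 ≤ (∑ i, p i * z i) ^ 2 / z₀ ^ 2 := by positivity
    have h3 : 0 ≤ ∑ i, z i ^ 2 := Finset.sum_nonneg fun i _ => sq_nonneg _
    simp only [hq]
    nlinarith [mul_nonneg (sub_nonneg.2 h1) (add_nonneg h3 h2)]
  have hlow : ∀ t, t < 1 → deriv M t = 0 := by
    intro t ht
    have : M =ᶠ[nhds t] fun _ => 0 := by
      filter_upwards [Iio_mem_nhds ht] with r hr
      exact smoothTransition.zero_of_nonpos (by simp at hr; linarith)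
    rw [this.deriv_eq]; simp
  have hhigh : ∀ t, 2 < t → deriv M t = 0 := by
    intro t ht
    have : M =ᶠ[nhds t] fun _ => 1 := by
      filter_upwards [Ioi_mem_nhds ht] with r hr
      exact smoothTransition.one_of_one_le (by simp at hr; linarith)
    rw [this.deriv_eq]; simp
  have hbig : ∀ z : 𝔼, z ∉ Metric.closedBall (0 : 𝔼) 2 → 2 < q z := by
    intro z hz'
    have : 2 < ‖z‖ := by simpa using hz'
    nlinarith [hqn z]
  set m : 𝔼 → ℝ := fun z => M (q z) - 1 with hm
  set ρ : 𝔼 → ℝ := fun z => 2 * deriv M (q z) with hρ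
  have hqc := hqC.continuous
  obtain ⟨c₀, hc₀, hball⟩ : ∃ c₀ > 0, ∀ z : 𝔼, ‖z‖ < c₀ → q z < 1 := by
    have h0 : q 0 < 1 := by simp [hq]
    obtain ⟨c, hc, h⟩ := Metric.isOpen_iff.1 (isOpen_lt hqc continuous_const) 0 h0
    exact ⟨c, hc, fun z hz => h (by simpa using hz)⟩
  have hρc : Continuous ρ := by fun_prop
  have hρcs : HasCompactSupport ρ := HasCompactSupport.intro (isCompact_closedBall (0 : 𝔼) 2)
    fun z hz' => by simp only [hρ]; rw [hhigh _ (hbig z hz'), mul_zero]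
  have hMnn : ∀ t, 0 ≤ deriv M t := by
    intro t
    have : Monotone M := fun x y hxy => smoothTransition.monotone (by linarith)
    exact this.deriv_nonneg
  refine ⟨m, ρ, c₀, hc₀, ?_, ?_, hρc, hρcs, ?_, ?_, ?_⟩
  · exact ((hMC.comp hqC).sub contDiff_const).of_le (by norm_num)
  · refine HasCompactSupport.intro (isCompact_closedBall (0 : 𝔼) 2) fun z hz' => ?_
    have := hbig z hz'
    simp only [hm, hM]
    rw [smoothTransition.one_of_one_le (by linarith), sub_self]
  · intro z i
    have hpm : ∀ j, pd m j z = deriv M (q z) * pd q j z := by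
      intro j
      have h1 : HasFDerivAt m (deriv M (q z) • fderiv ℝ q z) z := by
        have := (hMd (q z)).hasDerivAt.comp_hasFDerivAt z (hqC.differentiable (by norm_num) z).hasFDerivAt
        exact this.sub_const 1
      rw [pd, h1.fderiv]; rfl
    simp_rw [hpm, hpdq, ha]
    have e : ∀ j, z₀ / s₀ * ((if i = j then (1 : ℝ) else 0) - p i * p j / s₀ ^ 2) *
        (deriv M (q z) * (s₀ / z₀ * (2 * z j + 2 * (∑ i, p i * z i) * p j / z₀ ^ 2))) =
        2 * deriv M (q z) * ((if i = j then (z j + (∑ i, p i * z i) * p j / z₀ ^ 2) else 0)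
          - p i / s₀ ^ 2 * (p j * z j) - p i * (∑ i, p i * z i) / (s₀ ^ 2 * z₀ ^ 2) * p j ^ 2) := by
      intro j
      split_ifs <;> field_simp <;> ring
    simp_rw [e]
    rw [← Finset.mul_sum, Finset.sum_sub_distrib, Finset.sum_sub_distrib, ← Finset.mul_sum, ← Finset.mul_sum]
    simp only [Finset.sum_ite_eq, Finset.mem_univ, if_true]
    have e3 : ∑ i, p i ^ 2 = s₀ ^ 2 - z₀ ^ 2 := by linarith
    rw [e3]
    simp only [hρ]
    field_simp
    ring
  · intro z hz'
    simp only [hρ]; rw [hlow _ (hball z hz'), mul_zero]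
  · obtain ⟨t, ht, hdt⟩ := exists_deriv_eq_slope M (a := 1) (b := 2) (by norm_num)
      hMd.continuous.continuousOn hMd.differentiableOn
    have hdt1 : deriv M t = 1 := by
      rw [hdt]; simp only [hM]
      norm_num
    set e : 𝔼 := EuclideanSpace.single i₀ 1
    have hqe : 0 < q e := by
      have := hqn e
      have h1 : ‖e‖ = 1 := by simp [e]
      rw [h1] at this
      linarith
    have hsc : ∀ (c : ℝ), q (c • e) = c ^ 2 * q e := by
      intro c
      simp only [hq, PiLp.smul_apply, smul_eq_mul, mul_pow, mul_left_comm _ c, ← Finset.mul_sum]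
      ring
    have hx : ρ (√(t / q e) • e) ≠ 0 := by
      simp only [hρ]
      rw [hsc, Real.sq_sqrt (div_nonneg (by linarith [ht.1]) hqe.le), div_mul_cancel₀ _ hqe.ne', hdt1]
      norm_num
    exact (hρc.integral_pos_of_hasCompactSupport_nonneg_nonzero hρcs
      (fun z => mul_nonneg (by norm_num) (hMnn _)) hx).ne'

end
end RH
end


section
open Real Set MeasureTheory Filter Topology
namespace RH

theorem abstract_ift {P X : Type} [NormedAddCommGroup P] [NormedSpace ℝ P] [CompleteSpace P]
    [NormedAddCommGroup X] [NormedSpace ℝ X] [CompleteSpace X] (Φ : P × X → X)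
    (hΦ : AnalyticAt ℝ Φ 0) (h0 : Φ 0 = 0)
    (hd : HasFDerivAt (fun g => Φ (0, g)) (0 : X →L[ℝ] X) 0) :
    ∃ ψ : P → X, ∀ᶠ q : P × X in 𝓝 0, AnalyticAt ℝ ψ q.1 ∧ (q.2 = Φ q → q.2 = ψ q.1) := by
  set D := fderiv ℝ Φ 0 with hD
  have hDs : HasStrictFDerivAt Φ D 0 := hΦ.hasStrictFDerivAt
  have hDr : ∀ g, D (0, g) = 0 := by
    intro g
    have h1 : HasFDerivAt (fun g : X => Φ (0, g)) (D.comp (ContinuousLinearMap.inr ℝ P X)) 0 := by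
      have h2 : HasFDerivAt Φ D ((ContinuousLinearMap.inr ℝ P X) 0) := by
        exact hDs.hasFDerivAt
      exact h2.comp (0 : X) (ContinuousLinearMap.inr ℝ P X).hasFDerivAt
    have := h1.unique hd
    have := congrArg (fun T => T g) this
    simpa using this
  have hDl : ∀ q : P × X, D q = D (q.1, 0) := by
    intro q
    have : q = (q.1, 0) + (0, q.2) := by simp
    conv_lhs => rw [this, map_add, hDr, add_zero]
  set F : P × X → P × X := fun q => (q.1, q.2 - Φ q) with hF
  have hFa : AnalyticAt ℝ F 0 := analyticAt_fst.prod (analyticAt_snd.sub hΦ)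
  set A : P × X →L[ℝ] P × X := (ContinuousLinearMap.fst ℝ P X).prod (ContinuousLinearMap.snd ℝ P X - D) with hA
  set B : P × X →L[ℝ] P × X := (ContinuousLinearMap.fst ℝ P X).prod (ContinuousLinearMap.snd ℝ P X + D) with hB
  have hFd : HasStrictFDerivAt F A 0 :=
    (hasStrictFDerivAt_fst).prodMk (hasStrictFDerivAt_snd.sub hDs)
  set e : (P × X) ≃L[ℝ] (P × X) := ContinuousLinearEquiv.equivOfInverse A B
    (fun q => by
      simp only [hA, hB, ContinuousLinearMap.prod_apply, ContinuousLinearMap.coe_fst', ContinuousLinearMap.coe_snd',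
        sub_apply, add_apply]
      rw [hDl (q.1, q.2 - D q)]; simp [← hDl q])
    (fun q => by
      simp only [hA, hB, ContinuousLinearMap.prod_apply, ContinuousLinearMap.coe_fst', ContinuousLinearMap.coe_snd',
        sub_apply, add_apply]
      rw [hDl (q.1, q.2 + D q)]; simp [← hDl q]) with he
  have hFe : HasStrictFDerivAt F (e : P × X →L[ℝ] P × X) 0 := hFd
  set H := hFe.toOpenPartialHomeomorph F with hH
  have hHc : (H : P × X → P × X) = F := hFe.toOpenPartialHomeomorph_coe
  have hsrc : (0 : P × X) ∈ H.source := hFe.mem_toOpenPartialHomeomorph_source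
  have hF0 : F 0 = 0 := by simp [hF, h0]
  have hsymm : AnalyticAt ℝ H.symm 0 := by
    have := H.analyticAt_symm' (𝕜 := ℝ) (i := e) hsrc (by rw [hHc]; exact hFa) (by rw [hHc]; exact hFe.hasFDerivAt.fderiv)
    rwa [hHc, hF0] at this
  refine ⟨fun y => (H.symm (y, 0)).2, ?_⟩
  have c1 : Tendsto (fun q : P × X => (q.1, (0 : X))) (𝓝 0) (𝓝 0) := by
    have : Continuous (fun q : P × X => (q.1, (0 : X))) := by fun_prop
    exact this.tendsto 0
  filter_upwards [c1.eventually hsymm.eventually_analyticAt, H.open_source.mem_nhds hsrc] with q h1 h2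
  constructor
  · have h3 : AnalyticAt ℝ (fun y : P => (y, (0 : X))) q.1 := analyticAt_id.prod analyticAt_const
    have h4 := AnalyticAt.fun_comp (g := H.symm) (f := fun y : P => (y, (0 : X))) (x := q.1) h1 h3
    exact AnalyticAt.fun_comp (analyticAt_snd) h4
  · intro hq
    have : F q = (q.1, 0) := by simp only [hF]; rw [← hq, sub_self]
    have h5 := H.left_inv h2
    rw [hHc, this] at h5
    simp only [h5]

section
variable {E : Type} [MetricSpace E]

theorem exists_isq {s : ℝ} (hs : 0 < s) : ∃ R : Hol E → Hol E,
    AnalyticAt ℝ R (algebraMap ℝ (Hol E) (s ^ 2)) ∧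
    HasFDerivAt R ((-(1 / (2 * s ^ 3))) • ContinuousLinearMap.id ℝ (Hol E)) (algebraMap ℝ (Hol E) (s ^ 2)) ∧
    R (algebraMap ℝ (Hol E) (s ^ 2)) = algebraMap ℝ (Hol E) s⁻¹ ∧
    ∀ᶠ f in 𝓝 (algebraMap ℝ (Hol E) (s ^ 2)), ∀ x, R f x = (√(f x))⁻¹ := by
  set b : Hol E := algebraMap ℝ (Hol E) s with hb
  have hbb : b * b = algebraMap ℝ (Hol E) (s ^ 2) := by rw [hb, ← map_mul, sq]
  have h2s : (2 * s) ≠ 0 := by positivity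
  set e : Hol E ≃L[ℝ] Hol E := ContinuousLinearEquiv.smulLeft (Units.mk0 (2 * s) h2s) with he
  have hsq : HasStrictFDerivAt (fun y : Hol E => y * y) (e : Hol E →L[ℝ] Hol E) b := by
    have := (hasStrictFDerivAt_id (𝕜 := ℝ) b).mul' (hasStrictFDerivAt_id (𝕜 := ℝ) b)
    refine HasStrictFDerivAt.congr_fderiv (f := fun y : Hol E => y * y) this ?_
    ext f x
    simp [he, hb, Units.smul_def]
    ring
  have hsqa : AnalyticAt ℝ (fun y : Hol E => y * y) b := analyticAt_id.mul analyticAt_id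
  set H := hsq.toOpenPartialHomeomorph _ with hH
  have hHc : (H : Hol E → Hol E) = fun y => y * y := hsq.toOpenPartialHomeomorph_coe
  have hsrc : b ∈ H.source := hsq.mem_toOpenPartialHomeomorph_source
  have hsymma : AnalyticAt ℝ H.symm (b * b) := by
    have := H.analyticAt_symm' (𝕜 := ℝ) (i := e) hsrc (by rw [hHc]; exact hsqa) (by rw [hHc]; exact hsq.hasFDerivAt.fderiv)
    rwa [hHc] at this
  have hsymmd : HasFDerivAt H.symm (e.symm : Hol E →L[ℝ] Hol E) (b * b) := hsq.to_localInverse.hasFDerivAt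
  have hsb : H.symm (b * b) = b := by
    have := H.left_inv hsrc
    rwa [hHc] at this
  have hbu : b * algebraMap ℝ (Hol E) s⁻¹ = 1 := by rw [hb, ← map_mul, mul_inv_cancel₀ hs.ne', map_one]
  set bu : (Hol E)ˣ := ⟨b, algebraMap ℝ (Hol E) s⁻¹, hbu, by rw [mul_comm]; exact hbu⟩ with hbud
  have hbuv : (bu : Hol E) = b := rfl
  refine ⟨fun f => Ring.inverse (H.symm f), ?_, ?_, ?_, ?_⟩
  · rw [← hbb]
    refine AnalyticAt.fun_comp ?_ hsymma
    rw [hsb, ← hbuv]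
    exact analyticAt_inverse bu
  · rw [← hbb]
    have h1 := hasFDerivAt_ringInverse (𝕜 := ℝ) bu
    rw [hbuv, ← hsb] at h1
    have h2 := h1.comp (b * b) hsymmd
    refine HasFDerivAt.congr_fderiv h2 ?_
    refine ContinuousLinearMap.ext fun f => ?_
    have h3 : e.symm f = (2 * s)⁻¹ • f := by
      rw [ContinuousLinearEquiv.symm_apply_eq]
      have : e ((2 * s)⁻¹ • f) = (2 * s) • ((2 * s)⁻¹ • f) := rfl
      rw [this, smul_smul, mul_inv_cancel₀ h2s, one_smul]
    have h4 : ((-((ContinuousLinearMap.mulLeftRight ℝ (Hol E)) ↑bu⁻¹) ↑bu⁻¹) ∘SL (e.symm : Hol E →L[ℝ] Hol E)) f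
        = -(algebraMap ℝ (Hol E) s⁻¹ * e.symm f * algebraMap ℝ (Hol E) s⁻¹) := rfl
    rw [h4, h3]
    ext x
    have h5 : ((-(1 / (2 * s ^ 3))) • ContinuousLinearMap.id ℝ (Hol E)) f x = (-(1 / (2 * s ^ 3))) * f x := rfl
    rw [h5]
    simp only [Hol.neg_apply, Hol.mul_apply, Hol.algebraMap_apply, Hol.smul_apply]
    field_simp
  · rw [← hbb]
    simp only
    rw [hsb, ← hbuv, Ring.inverse_unit]
    rfl
  · rw [← hbb]
    have hcont := hsymma.continuousAt
    have hu : ∀ᶠ y in 𝓝 b, IsUnit y := by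
      have := Units.isOpen.mem_nhds (show (b : Hol E) ∈ {x | IsUnit x} from hbuv ▸ bu.isUnit)
      exact this
    have hpos : ∀ᶠ y in 𝓝 b, ∀ x, 0 < y x := by
      filter_upwards [Metric.ball_mem_nhds b hs] with y hy x
      have h1 := Hol.abs_le (y - b) x
      have h2 : ‖y - b‖ < s := by rwa [mem_ball_iff_norm] at hy
      have h3 : (y - b) x = y x - s := rfl
      rw [h3] at h1
      have := (abs_lt.1 (h1.trans_lt h2)).1
      linarith
    have ht : Tendsto H.symm (𝓝 (b * b)) (𝓝 b) := by
      have := hcont.tendsto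
      rwa [hsb] at this
    have hbt : b * b ∈ H.target := by
      have := H.map_source hsrc
      rwa [hHc] at this
    filter_upwards [ht.eventually hu, ht.eventually hpos, H.open_target.mem_nhds hbt] with f f1 f2 f3 x
    have e1 : H.symm f * H.symm f = f := by
      have := H.right_inv f3
      rwa [hHc] at this
    have e2 : (H.symm f * Ring.inverse (H.symm f)) x = 1 := by
      rw [Ring.mul_inverse_cancel _ f1]; rfl
    have e3 : f x = (H.symm f x) * (H.symm f x) := by
      conv_lhs => rw [← e1]
      rfl
    rw [e3, Real.sqrt_mul_self (f2 x).le]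
    rw [Hol.mul_apply] at e2
    exact eq_inv_of_mul_eq_one_right e2

end
end RH
end


section
open Real Set MeasureTheory Filter Topology
namespace RH
section
variable {n : ℕ}
local notation "𝔼" => EuclideanSpace ℝ (Fin n)
local notation "ℍ" => Hol (EuclideanSpace ℝ (Fin n))

/-- parameter space -/
abbrev Par (n : ℕ) := EuclideanSpace ℝ (Fin n) × ℝ × Hol (EuclideanSpace ℝ (Fin n)) ×
  (Fin n → Hol (EuclideanSpace ℝ (Fin n)))

/-- unknowns -/
abbrev Unk (n : ℕ) := Fin n → Hol (EuclideanSpace ℝ (Fin n))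

/-- the data entering the fixed point map -/
structure Dat (n : ℕ) where
  i₀ : Fin n
  z₀ : ℝ
  s₀ : ℝ
  p : Fin n → ℝ
  a : Fin n → Fin n → ℝ
  R : Hol (EuclideanSpace ℝ (Fin n)) → Hol (EuclideanSpace ℝ (Fin n))
  ηd : Fin n → Hol (EuclideanSpace ℝ (Fin n))
  χ : Hol (EuclideanSpace ℝ (Fin n))
  Av : Hol (EuclideanSpace ℝ (Fin n)) →L[ℝ] Hol (EuclideanSpace ℝ (Fin n))
  J : Fin n → Fin n → Hol (EuclideanSpace ℝ (Fin n)) →L[ℝ] Hol (EuclideanSpace ℝ (Fin n))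
  c : ℝ

namespace Dat
variable (d : Dat n)

/-- the Nemytskii operator of the flux -/
noncomputable def N (w : ℍ) (P : Fin n → ℍ) (j : Fin n) : ℍ :=
  w * P j * d.R (w * w + ∑ i, P i * P i)

noncomputable def tt (q : Par n × Unk n) : ℍ := ∑ i, (q.1.1 i) • d.ηd i
noncomputable def U1 (q : Par n × Unk n) : ℍ := algebraMap ℝ ℍ d.z₀ + q.1.2.2.1
noncomputable def P1 (q : Par n × Unk n) (i : Fin n) : ℍ := algebraMap ℝ ℍ (d.p i) + q.1.2.2.2 i
noncomputable def ww (q : Par n × Unk n) : ℍ := d.U1 q - q.1.2.1 • (d.χ * d.Av (q.2 d.i₀))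
noncomputable def QQ (q : Par n × Unk n) (i : Fin n) : ℍ := d.P1 q i + q.2 i
noncomputable def qq (q : Par n × Unk n) (i : Fin n) : ℍ :=
  d.QQ q i - d.ηd i * (∑ l, (q.1.1 l) • d.QQ q l) * Ring.inverse (1 + d.tt q)
noncomputable def GG (q : Par n × Unk n) (j : Fin n) : ℍ :=
  (1 + d.tt q) * d.N (d.ww q) (d.qq q) j - (q.1.1 j) • (∑ k, d.ηd k * d.N (d.ww q) (d.qq q) k)
    - d.N (d.U1 q) (d.P1 q) j
noncomputable def Phi (q : Par n × Unk n) : Unk n := fun k =>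
  d.c⁻¹ • (d.χ * ∑ j, d.J k j ((∑ i, d.a i j • q.2 i) - d.GG q j))

/-- standing hypotheses -/
structure Good : Prop where
  hs : 0 < d.s₀
  hsz : d.s₀ ^ 2 = d.z₀ ^ 2 + ∑ i, d.p i ^ 2
  ha : ∀ i j, d.a i j = d.z₀ / d.s₀ * ((if i = j then 1 else 0) - d.p i * d.p j / d.s₀ ^ 2)
  hR : AnalyticAt ℝ d.R (algebraMap ℝ ℍ (d.s₀ ^ 2))
  hR' : HasFDerivAt d.R ((-(1 / (2 * d.s₀ ^ 3))) • ContinuousLinearMap.id ℝ ℍ) (algebraMap ℝ ℍ (d.s₀ ^ 2))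
  hR0 : d.R (algebraMap ℝ ℍ (d.s₀ ^ 2)) = algebraMap ℝ ℍ d.s₀⁻¹
  hRx : ∀ᶠ f in 𝓝 (algebraMap ℝ ℍ (d.s₀ ^ 2)), ∀ x, d.R f x = (√(f x))⁻¹

variable {d}

theorem an_xi (i : Fin n) (q₀) : AnalyticAt ℝ (fun q : Par n × Unk n => q.1.1 i) q₀ :=
  (((EuclideanSpace.proj i : 𝔼 →L[ℝ] ℝ).comp (ContinuousLinearMap.fst ℝ _ _)).comp
    (ContinuousLinearMap.fst ℝ (Par n) (Unk n))).analyticAt q₀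

theorem an_g (i : Fin n) (q₀) : AnalyticAt ℝ (fun q : Par n × Unk n => q.2 i) q₀ :=
  ((ContinuousLinearMap.proj i : (Unk n) →L[ℝ] ℍ).comp
    (ContinuousLinearMap.snd ℝ (Par n) (Unk n))).analyticAt q₀

theorem an_P (i : Fin n) (q₀) : AnalyticAt ℝ (fun q : Par n × Unk n => q.1.2.2.2 i) q₀ :=
  ((ContinuousLinearMap.proj i : (Unk n) →L[ℝ] ℍ).comp ((ContinuousLinearMap.snd ℝ _ _).comp
    ((ContinuousLinearMap.snd ℝ _ _).comp ((ContinuousLinearMap.snd ℝ _ _).comp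
    (ContinuousLinearMap.fst ℝ (Par n) (Unk n)))))).analyticAt q₀

theorem an_U (q₀) : AnalyticAt ℝ (fun q : Par n × Unk n => q.1.2.2.1) q₀ :=
  ((ContinuousLinearMap.fst ℝ _ _).comp
    ((ContinuousLinearMap.snd ℝ _ _).comp ((ContinuousLinearMap.snd ℝ _ _).comp
    (ContinuousLinearMap.fst ℝ (Par n) (Unk n))))).analyticAt q₀

theorem an_r (q₀) : AnalyticAt ℝ (fun q : Par n × Unk n => q.1.2.1) q₀ :=
  ((ContinuousLinearMap.fst ℝ _ _).comp ((ContinuousLinearMap.snd ℝ _ _).comp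
    (ContinuousLinearMap.fst ℝ (Par n) (Unk n)))).analyticAt q₀

theorem an_sum {ι Z W : Type} [NormedAddCommGroup Z] [NormedSpace ℝ Z] [NormedAddCommGroup W] [NormedSpace ℝ W]
    (s : Finset ι) {f : ι → Z → W} {z : Z} (h : ∀ i, AnalyticAt ℝ (f i) z) :
    AnalyticAt ℝ (fun y => ∑ i ∈ s, f i y) z := Finset.analyticAt_fun_sum s fun i _ => h i

theorem an_clm {Z W V : Type} [NormedAddCommGroup Z] [NormedSpace ℝ Z] [NormedAddCommGroup W] [NormedSpace ℝ W]
    [NormedAddCommGroup V] [NormedSpace ℝ V] (T : W →L[ℝ] V)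
    {f : Z → W} {z : Z} (h : AnalyticAt ℝ f z) :
    AnalyticAt ℝ (fun y => T (f y)) z := AnalyticAt.fun_comp (T.analyticAt _) h

theorem an_tt (q₀) : AnalyticAt ℝ d.tt q₀ := an_sum _ fun i => (an_xi i q₀).smul analyticAt_const
theorem an_U1 (q₀) : AnalyticAt ℝ d.U1 q₀ := analyticAt_const.add (an_U q₀)
theorem an_P1 (i) (q₀) : AnalyticAt ℝ (fun q => d.P1 q i) q₀ := analyticAt_const.add (an_P i q₀)
theorem an_QQ (i) (q₀) : AnalyticAt ℝ (fun q => d.QQ q i) q₀ := (an_P1 i q₀).add (an_g i q₀)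
theorem an_ww (q₀) : AnalyticAt ℝ d.ww q₀ :=
  (an_U1 q₀).sub ((an_r q₀).smul (analyticAt_const.mul (an_clm d.Av (an_g _ q₀))))

theorem tt_zero (g : Unk n) : d.tt (0, g) = 0 := by simp [tt]
theorem an_qq (i) : AnalyticAt ℝ (fun q => d.qq q i) 0 := by
  refine (an_QQ i 0).sub ((analyticAt_const.mul (an_sum _ fun l => (an_xi l 0).smul (an_QQ l 0))).mul ?_)
  refine AnalyticAt.fun_comp (g := Ring.inverse) ?_ (analyticAt_const.add (an_tt 0))
  have : (1 : ℍ) + d.tt 0 = ((1 : ℍˣ) : ℍ) := by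
    rw [show (0 : Par n × Unk n) = (0, 0) from rfl, tt_zero]; simp
  rw [this]
  exact analyticAt_inverse _

theorem ww_zero (g : Unk n) : d.ww (0, g) = algebraMap ℝ ℍ d.z₀ := by simp [ww, U1]
theorem U1_zero (g : Unk n) : d.U1 (0, g) = algebraMap ℝ ℍ d.z₀ := by simp [U1]
theorem P1_zero (g : Unk n) (i) : d.P1 (0, g) i = algebraMap ℝ ℍ (d.p i) := by simp [P1]
theorem qq_zero (g : Unk n) (i) : d.qq (0, g) i = algebraMap ℝ ℍ (d.p i) + g i := by simp [qq, QQ, P1]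

theorem GG_zero (g : Unk n) (j) : d.GG (0, g) j =
    d.N (algebraMap ℝ ℍ d.z₀) (fun i => algebraMap ℝ ℍ (d.p i) + g i) j -
    d.N (algebraMap ℝ ℍ d.z₀) (fun i => algebraMap ℝ ℍ (d.p i)) j := by
  have h1 : d.qq (0, g) = fun i => algebraMap ℝ ℍ (d.p i) + g i := funext (qq_zero g)
  have h2 : d.P1 (0, g) = fun i => algebraMap ℝ ℍ (d.p i) := funext (P1_zero g)
  simp only [GG, tt_zero, ww_zero, U1_zero, h1, h2]
  simp

theorem Good.base (h : d.Good) : algebraMap ℝ ℍ d.z₀ * algebraMap ℝ ℍ d.z₀ +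
    ∑ i, algebraMap ℝ ℍ (d.p i) * algebraMap ℝ ℍ (d.p i) = algebraMap ℝ ℍ (d.s₀ ^ 2) := by
  rw [h.hsz]
  simp only [← map_mul, ← map_sum, ← map_add, sq]

theorem Good.an_N (h : d.Good) {Z : Type} [NormedAddCommGroup Z] [NormedSpace ℝ Z] {w : Z → ℍ} {P : Z → Fin n → ℍ} {y : Z}
    (hw : AnalyticAt ℝ w y) (hP : ∀ i, AnalyticAt ℝ (fun z => P z i) y)
    (hw0 : w y = algebraMap ℝ ℍ d.z₀) (hP0 : ∀ i, P y i = algebraMap ℝ ℍ (d.p i)) (j) :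
    AnalyticAt ℝ (fun z => d.N (w z) (P z) j) y := by
  refine (hw.mul (hP j)).mul (AnalyticAt.fun_comp (g := d.R) ?_ ((hw.mul hw).add (an_sum _ fun i => (hP i).mul (hP i))))
  simp only [hw0, hP0]
  rw [h.base]
  exact h.hR

theorem Good.an_N1 (h : d.Good) (j) : AnalyticAt ℝ (fun q => d.N (d.ww q) (d.qq q) j) 0 :=
  h.an_N (an_ww 0) (fun i => an_qq i) (ww_zero 0) (fun i => (qq_zero 0 i).trans (by simp)) j

theorem Good.an_N0 (h : d.Good) (j) : AnalyticAt ℝ (fun q => d.N (d.U1 q) (d.P1 q) j) 0 :=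
  h.an_N (an_U1 0) (fun i => an_P1 i 0) (U1_zero 0) (fun i => P1_zero 0 i) j

theorem Good.an_GG (h : d.Good) (j) : AnalyticAt ℝ (fun q => d.GG q j) 0 := by
  have h1 : AnalyticAt ℝ (fun q => (1 + d.tt q) * d.N (d.ww q) (d.qq q) j) 0 :=
    (analyticAt_const.add (an_tt 0)).mul (h.an_N1 j)
  have h2 : AnalyticAt ℝ (fun q => ∑ k, d.ηd k * d.N (d.ww q) (d.qq q) k) 0 :=
    an_sum _ fun k => analyticAt_const.mul (h.an_N1 k)
  have h3 : AnalyticAt ℝ (fun q : Par n × Unk n => (q.1.1 j) • (∑ k, d.ηd k * d.N (d.ww q) (d.qq q) k)) 0 :=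
    (an_xi j 0).smul h2
  exact (h1.sub h3).sub (h.an_N0 j)

theorem Good.an_Phi_apply (h : d.Good) (k) : AnalyticAt ℝ (fun q => d.Phi q k) 0 := by
  have hS : ∀ i j, AnalyticAt ℝ (fun q : Par n × Unk n => d.a i j • q.2 i) 0 := fun i j =>
    (analyticAt_const (v := d.a i j)).smul (an_g i 0)
  have hS' : ∀ j, AnalyticAt ℝ (fun q : Par n × Unk n => ∑ i, d.a i j • q.2 i) 0 := fun j =>
    an_sum Finset.univ fun i => hS i j
  have hL : ∀ j, AnalyticAt ℝ (fun q : Par n × Unk n => (∑ i, d.a i j • q.2 i) - d.GG q j) 0 := fun j =>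
    (hS' j).sub (h.an_GG j)
  have hJ : ∀ j, AnalyticAt ℝ (fun q : Par n × Unk n => d.J k j ((∑ i, d.a i j • q.2 i) - d.GG q j)) 0 :=
    fun j => an_clm (d.J k j) (hL j)
  have hJs := an_sum Finset.univ hJ
  have hJm : AnalyticAt ℝ (fun q : Par n × Unk n => d.χ * ∑ j, d.J k j ((∑ i, d.a i j • q.2 i) - d.GG q j)) 0 :=
    analyticAt_const.mul hJs
  exact (analyticAt_const (v := d.c⁻¹)).smul hJm

theorem Good.an_Phi (h : d.Good) : AnalyticAt ℝ d.Phi 0 :=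
  AnalyticAt.pi fun k => h.an_Phi_apply k

theorem Phi_zero : d.Phi 0 = 0 := by
  funext k
  rw [show (0 : Par n × Unk n) = (0, 0) from rfl]
  simp [Phi, GG_zero]

theorem Good.deriv_N (h : d.Good) (j : Fin n) : HasFDerivAt
    (fun g : Unk n => d.N (algebraMap ℝ ℍ d.z₀) (fun i => algebraMap ℝ ℍ (d.p i) + g i) j)
    (∑ i, d.a i j • (ContinuousLinearMap.proj i : (Unk n) →L[ℝ] ℍ)) 0 := by
  have hg : ∀ i, HasFDerivAt (fun g : Unk n => algebraMap ℝ ℍ (d.p i) + g i)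
      (ContinuousLinearMap.proj i : (Unk n) →L[ℝ] ℍ) 0 := fun i =>
    ((ContinuousLinearMap.proj i : (Unk n) →L[ℝ] ℍ).hasFDerivAt).const_add _
  have hS := (HasFDerivAt.fun_sum (u := Finset.univ) fun i _ => (hg i).mul (hg i)).const_add
    (algebraMap ℝ ℍ d.z₀ * algebraMap ℝ ℍ d.z₀)
  have hR := h.hR'
  have e0 : algebraMap ℝ ℍ d.z₀ * algebraMap ℝ ℍ d.z₀ + ∑ i, (algebraMap ℝ ℍ (d.p i) + (0 : Unk n) i)
      * (algebraMap ℝ ℍ (d.p i) + (0 : Unk n) i) = algebraMap ℝ ℍ (d.s₀ ^ 2) := by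
    rw [← h.base]; simp
  rw [← e0] at hR
  have hc := hR.comp (0 : Unk n) hS
  have := ((hg j).const_mul (algebraMap ℝ ℍ d.z₀)).mul hc
  refine HasFDerivAt.congr_fderiv this ?_
  refine ContinuousLinearMap.ext fun g => ?_
  ext x
  have e1 : (∑ i, d.a i j • (ContinuousLinearMap.proj i : (Unk n) →L[ℝ] ℍ)) g = ∑ i, d.a i j • g i := by
    simp
  rw [e1]
  simp [Hol.sum_apply, h.ha, sub_mul, mul_sub, Finset.sum_sub_distrib]
  rw [h.base, h.hR0, Hol.algebraMap_apply]
  have e2 : ∑ i, (d.p i * (g i) x + d.p i * (g i) x) = 2 * ∑ i, d.p i * (g i) x := by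
    rw [Finset.mul_sum]; exact Finset.sum_congr rfl fun i _ => by ring
  have e3 : ∑ i, d.z₀ / d.s₀ * (d.p i * d.p j / d.s₀ ^ 2) * (g i) x =
      d.z₀ * d.p j / d.s₀ ^ 3 * ∑ i, d.p i * (g i) x := by
    rw [Finset.mul_sum]; exact Finset.sum_congr rfl fun i _ => by field_simp
  rw [e2, e3]
  ring

theorem Good.deriv_Phi (h : d.Good) :
    HasFDerivAt (fun g => d.Phi (0, g)) (0 : Unk n →L[ℝ] Unk n) 0 := by
  rw [hasFDerivAt_pi']
  intro k
  have h1 : ∀ j, HasFDerivAt (fun g : Unk n => (∑ i, d.a i j • g i) - d.GG (0, g) j) (0 : Unk n →L[ℝ] ℍ) 0 := by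
    intro j
    have e1 : HasFDerivAt (fun g : Unk n => ∑ i, d.a i j • g i)
        (∑ i, d.a i j • (ContinuousLinearMap.proj i : (Unk n) →L[ℝ] ℍ)) 0 := by
      have := (∑ i, d.a i j • (ContinuousLinearMap.proj i : (Unk n) →L[ℝ] ℍ)).hasFDerivAt (x := (0 : Unk n))
      refine this.congr_of_eventuallyEq (Eventually.of_forall fun g => ?_)
      simp
    have e2 := e1.sub ((h.deriv_N j).sub_const (d.N (algebraMap ℝ ℍ d.z₀) (fun i => algebraMap ℝ ℍ (d.p i)) j))
    rw [sub_self] at e2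
    refine e2.congr_of_eventuallyEq (Eventually.of_forall fun g => ?_)
    simp only [Pi.sub_apply, GG_zero]
  have h2 : ∀ j, HasFDerivAt (fun g : Unk n => d.J k j ((∑ i, d.a i j • g i) - d.GG (0, g) j)) (0 : Unk n →L[ℝ] ℍ) 0 := by
    intro j
    have := ((d.J k j).hasFDerivAt).comp (0 : Unk n) (h1 j)
    rw [ContinuousLinearMap.comp_zero] at this
    exact this
  have h3 := ((HasFDerivAt.fun_sum (u := Finset.univ) fun j _ => h2 j).const_mul d.χ).const_smul d.c⁻¹
  refine HasFDerivAt.congr_fderiv h3 ?_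
  simp

theorem Good.exists_psi (h : d.Good) : ∃ ψ : Par n → Unk n, ∀ᶠ q : Par n × Unk n in 𝓝 0,
    AnalyticAt ℝ ψ q.1 ∧ (q.2 = d.Phi q → q.2 = ψ q.1) :=
  abstract_ift d.Phi h.an_Phi Phi_zero h.deriv_Phi

/-- pointwise formula for the Nemytskii operators, near the base point -/
theorem Good.eventually_pw (h : d.Good) : ∀ᶠ q : Par n × Unk n in 𝓝 0,
    (∀ j x, d.N (d.ww q) (d.qq q) j x = d.ww q x * d.qq q j x / √((d.ww q x) ^ 2 + ∑ i, (d.qq q i x) ^ 2)) ∧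
    (∀ j x, d.N (d.U1 q) (d.P1 q) j x = d.U1 q x * d.P1 q j x / √((d.U1 q x) ^ 2 + ∑ i, (d.P1 q i x) ^ 2)) ∧
    (∀ x, (1 + d.tt q x) * (Ring.inverse (1 + d.tt q)) x = 1) := by
  have z : (0 : Par n × Unk n) = (0, 0) := rfl
  have c1 : ContinuousAt (fun q => d.ww q * d.ww q + ∑ i, d.qq q i * d.qq q i) 0 :=
    (((an_ww 0).mul (an_ww 0)).add (an_sum _ fun i => (an_qq i).mul (an_qq i))).continuousAt
  have c2 : ContinuousAt (fun q => d.U1 q * d.U1 q + ∑ i, d.P1 q i * d.P1 q i) 0 :=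
    (((an_U1 0).mul (an_U1 0)).add (an_sum _ fun i => (an_P1 i 0).mul (an_P1 i 0))).continuousAt
  have c3 : ContinuousAt (fun q => 1 + d.tt q) 0 := (analyticAt_const.add (an_tt 0)).continuousAt
  have v1 : d.ww 0 * d.ww 0 + ∑ i, d.qq 0 i * d.qq 0 i = algebraMap ℝ ℍ (d.s₀ ^ 2) := by
    simp only [z, ww_zero, qq_zero, ← h.base]; simp
  have v2 : d.U1 0 * d.U1 0 + ∑ i, d.P1 0 i * d.P1 0 i = algebraMap ℝ ℍ (d.s₀ ^ 2) := by
    simp only [z, U1_zero, P1_zero, ← h.base]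
  have v3 : 1 + d.tt 0 = 1 := by simp only [z, tt_zero, add_zero]
  have hu : ∀ᶠ y in 𝓝 (1 : ℍ), IsUnit y := Units.isOpen.mem_nhds isUnit_one
  have t1 := c1.tendsto
  have t2 := c2.tendsto
  have t3 := c3.tendsto
  rw [v1] at t1
  rw [v2] at t2
  rw [v3] at t3
  filter_upwards [t1.eventually h.hRx, t2.eventually h.hRx, t3.eventually hu] with q h1 h2 h3
  refine ⟨fun j x => ?_, fun j x => ?_, fun x => ?_⟩
  · simp only [N, Hol.mul_apply]
    rw [h1 x, div_eq_mul_inv]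
    simp only [Hol.add_apply, Hol.sum_apply, Hol.mul_apply, sq]
  · simp only [N, Hol.mul_apply]
    rw [h2 x, div_eq_mul_inv]
    simp only [Hol.add_apply, Hol.sum_apply, Hol.mul_apply, sq]
  · have := congrArg (fun f : ℍ => f x) (Ring.mul_inverse_cancel _ h3)
    simpa using this

end Dat
end
end RH
end


section
open Real Set MeasureTheory Filter Topology
namespace RH
section
variable {n : ℕ}
local notation "𝔼" => EuclideanSpace ℝ (Fin n)

theorem pd_phi {f η : 𝔼 → ℝ} {x₀ ξ x : 𝔼} {r : ℝ} (hf : DifferentiableAt ℝ f (x₀ + r • (x + η x • ξ)))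
    (hη : DifferentiableAt ℝ η x) (k : Fin n) :
    pd (fun x => f (x₀ + r • (x + η x • ξ))) k x =
      r * (pd f k (x₀ + r • (x + η x • ξ)) + pd η k x * ∑ l, ξ l * pd f l (x₀ + r • (x + η x • ξ))) := by
  have h1 : HasFDerivAt (fun x : 𝔼 => x₀ + r • (x + η x • ξ))
      (r • (ContinuousLinearMap.id ℝ 𝔼 + (fderiv ℝ η x).smulRight ξ)) x :=
    (((hasFDerivAt_id x).add (hη.hasFDerivAt.smul_const ξ)).const_smul r).const_add x₀
  have h2 := hf.hasFDerivAt.comp x h1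
  have h3 : fderiv ℝ (fun x => f (x₀ + r • (x + η x • ξ))) x = _ := h2.fderiv
  rw [pd, h3, ← fderiv_eq_sum]
  simp [pd]
  ring

theorem piola {A : Fin n → 𝔼 → ℝ} {η : 𝔼 → ℝ} {x₀ ξ x : 𝔼} {r : ℝ}
    (hA : ∀ i, DifferentiableAt ℝ (A i) (x₀ + r • (x + η x • ξ))) (hη : ContDiff ℝ 2 η) :
    ∑ j, pd (fun x => (1 + ∑ i, ξ i * pd η i x) * A j (x₀ + r • (x + η x • ξ)) -
      ξ j * ∑ k, pd η k x * A k (x₀ + r • (x + η x • ξ))) j x =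
    (1 + ∑ i, ξ i * pd η i x) * r * ∑ j, pd (A j) j (x₀ + r • (x + η x • ξ)) := by
  have hηd : DifferentiableAt ℝ η x := hη.differentiable (by norm_num) x
  have hη' : ∀ i, DifferentiableAt ℝ (pd η i) x := fun i =>
    (contDiff_pd hη (l := 1) (by norm_num) i).differentiable (by norm_num) x
  have hφ : DifferentiableAt ℝ (fun x : 𝔼 => x₀ + r • (x + η x • ξ)) x :=
    (((differentiableAt_id).add (hηd.smul_const ξ)).const_smul r).const_add x₀
  have hAφ : ∀ i, DifferentiableAt ℝ (fun x => A i (x₀ + r • (x + η x • ξ))) x := fun i =>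
    (hA i).comp x hφ
  have ht : DifferentiableAt ℝ (fun x => ∑ i, ξ i * pd η i x) x :=
    DifferentiableAt.fun_sum fun i _ => (hη' i).const_mul _
  have ht1 : DifferentiableAt ℝ (fun x => 1 + ∑ i, ξ i * pd η i x) x := ht.const_add 1
  have hm : ∀ k, DifferentiableAt ℝ (fun x => pd η k x * A k (x₀ + r • (x + η x • ξ))) x := fun k =>
    (hη' k).mul (hAφ k)
  have hs : DifferentiableAt ℝ (fun x => ∑ k, pd η k x * A k (x₀ + r • (x + η x • ξ))) x :=
    DifferentiableAt.fun_sum fun k _ => hm k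
  have key : ∀ j, pd (fun x => (1 + ∑ i, ξ i * pd η i x) * A j (x₀ + r • (x + η x • ξ)) -
      ξ j * ∑ k, pd η k x * A k (x₀ + r • (x + η x • ξ))) j x =
      (1 + ∑ i, ξ i * pd η i x) * (r * (pd (A j) j (x₀ + r • (x + η x • ξ)) + pd η j x * ∑ l, ξ l * pd (A j) l (x₀ + r • (x + η x • ξ))))
      + A j (x₀ + r • (x + η x • ξ)) * (∑ i, ξ i * pd (pd η i) j x)
      - ξ j * ∑ k, (pd η k x * (r * (pd (A k) j (x₀ + r • (x + η x • ξ)) + pd η j x * ∑ l, ξ l * pd (A k) l (x₀ + r • (x + η x • ξ))))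
        + A k (x₀ + r • (x + η x • ξ)) * pd (pd η k) j x) := by
    intro j
    rw [pd_sub (ht1.fun_mul (hAφ j)) (hs.const_mul _), pd_mul ht1 (hAφ j), pd_const_mul _ hs,
      pd_sum Finset.univ (fun k x => pd η k x * A k (x₀ + r • (x + η x • ξ))) (fun k _ => hm k),
      pd_add (differentiableAt_const _) ht, pd_const, pd_sum Finset.univ (fun i x => ξ i * pd η i x) (fun i _ => (hη' i).const_mul _)]
    simp_rw [pd_mul (hη' _) (hAφ _), pd_const_mul _ (hη' _), pd_phi (hA _) hηd]
    ring
  simp_rw [key]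
  generalize (x₀ + r • (x + η x • ξ)) = y
  have e2 : ∑ j, A j y * (∑ i, ξ i * pd (pd η i) j x) = ∑ j, ξ j * ∑ k, A k y * pd (pd η k) j x := by
    simp_rw [Finset.mul_sum]
    rw [Finset.sum_comm]
    refine Finset.sum_congr rfl fun i _ => Finset.sum_congr rfl fun j _ => ?_
    rw [pd_comm hη i j]; ring
  have e3 : ∑ j, ξ j * ∑ k, pd η k x * pd (A k) j y = ∑ j, pd η j x * ∑ l, ξ l * pd (A j) l y := by
    simp_rw [Finset.mul_sum]
    rw [Finset.sum_comm]
    refine Finset.sum_congr rfl fun i _ => Finset.sum_congr rfl fun j _ => ?_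
    ring
  have e4 : ∀ j, (1 + ∑ i, ξ i * pd η i x) * (r * (pd (A j) j y + pd η j x * ∑ l, ξ l * pd (A j) l y))
      + A j y * (∑ i, ξ i * pd (pd η i) j x)
      - ξ j * ∑ k, (pd η k x * (r * (pd (A k) j y + pd η j x * ∑ l, ξ l * pd (A k) l y))
        + A k y * pd (pd η k) j x) =
      (1 + ∑ i, ξ i * pd η i x) * r * pd (A j) j y +
      (1 + ∑ i, ξ i * pd η i x) * r * (pd η j x * ∑ l, ξ l * pd (A j) l y)
      + A j y * (∑ i, ξ i * pd (pd η i) j x) - r * (ξ j * ∑ k, pd η k x * pd (A k) j y)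
      - r * (∑ k, pd η k x * ∑ l, ξ l * pd (A k) l y) * (ξ j * pd η j x)
      - ξ j * ∑ k, A k y * pd (pd η k) j x := by
    intro j
    have : ∑ k, (pd η k x * (r * (pd (A k) j y + pd η j x * ∑ l, ξ l * pd (A k) l y))
        + A k y * pd (pd η k) j x) = r * (∑ k, pd η k x * pd (A k) j y) +
        r * pd η j x * (∑ k, pd η k x * ∑ l, ξ l * pd (A k) l y) + ∑ k, A k y * pd (pd η k) j x := by
      rw [Finset.mul_sum, Finset.mul_sum, ← Finset.sum_add_distrib, ← Finset.sum_add_distrib]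
      exact Finset.sum_congr rfl fun k _ => by ring
    rw [this]
    ring
  rw [Finset.sum_congr rfl fun j _ => e4 j]
  simp only [Finset.sum_sub_distrib, Finset.sum_add_distrib]
  rw [← Finset.mul_sum, ← Finset.mul_sum, ← Finset.mul_sum, ← Finset.mul_sum, e2, e3]
  ring

end
end RH
end


section
open Real Set MeasureTheory Filter Topology
namespace RH
section
variable {n : ℕ}
local notation "𝔼" => EuclideanSpace ℝ (Fin n)

/-- the flux -/
noncomputable def flux (v : EuclideanSpace ℝ (Fin n) → ℝ) (i : Fin n) (y : EuclideanSpace ℝ (Fin n)) : ℝ :=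
  v y * pd v i y / √((v y) ^ 2 + ∑ i, (pd v i y) ^ 2)

/-- localisation data -/
structure Loc (v : EuclideanSpace ℝ (Fin n) → ℝ) (x₀ : EuclideanSpace ℝ (Fin n)) (ρ₀ : ℝ)
    (η : EuclideanSpace ℝ (Fin n) → ℝ) (Θ : EuclideanSpace ℝ (Fin n) → EuclideanSpace ℝ (Fin n))
    (r : ℝ) (ξ : EuclideanSpace ℝ (Fin n)) : Prop where
  hv : ContDiff ℝ 2 v
  hη : ContDiff ℝ 2 η
  hη0 : ∀ x, 1 < ‖x‖ → η x = 0
  hΘ : ContDiff ℝ 2 Θ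
  hΘid : ∀ x, ‖x‖ < 2 → Θ x = x
  hr : r ≠ 0
  hφ : ∀ x, x₀ + r • (Θ x + η x • ξ) ∈ Metric.ball x₀ ρ₀
  hφ0 : ∀ x, x₀ + r • Θ x ∈ Metric.ball x₀ ρ₀
  hpos : ∀ x ∈ Metric.ball x₀ ρ₀, 0 < v x
  hdiv : ∀ x ∈ Metric.ball x₀ ρ₀, relDiv v x = 0


/-- the deformed difference -/
noncomputable def hfun (v : EuclideanSpace ℝ (Fin n) → ℝ) (x₀ : EuclideanSpace ℝ (Fin n))
    (η : EuclideanSpace ℝ (Fin n) → ℝ) (Θ : EuclideanSpace ℝ (Fin n) → EuclideanSpace ℝ (Fin n))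
    (r : ℝ) (ξ : EuclideanSpace ℝ (Fin n)) (x : EuclideanSpace ℝ (Fin n)) : ℝ :=
  r⁻¹ * (v (x₀ + r • (Θ x + η x • ξ)) - v (x₀ + r • Θ x))

theorem flux_contDiffAt {v : 𝔼 → ℝ} (hv : ContDiff ℝ 2 v) {y : 𝔼} (hy : 0 < v y) (i : Fin n) : ContDiffAt ℝ 1 (flux v i) y := by
  have h1 : ContDiffAt ℝ 1 v y := (hv.of_le (by norm_num)).contDiffAt
  have h2 : ∀ i, ContDiffAt ℝ 1 (pd v i) y := fun i => (contDiff_pd hv (by norm_num) i).contDiffAt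
  have h3 : 0 < (v y) ^ 2 + ∑ i, (pd v i y) ^ 2 := by
    have : 0 ≤ ∑ i, (pd v i y) ^ 2 := Finset.sum_nonneg fun i _ => sq_nonneg _
    positivity
  refine (h1.mul (h2 i)).div ?_ (Real.sqrt_pos.2 h3).ne'
  exact ContDiffAt.sqrt ((h1.pow 2).add (ContDiffAt.sum fun i _ => (h2 i).pow 2)) h3.ne'

namespace Loc

theorem ev_id {v η : 𝔼 → ℝ} {Θ : 𝔼 → 𝔼} {x₀ ξ : 𝔼} {ρ₀ r : ℝ} (L : Loc v x₀ ρ₀ η Θ r ξ) {x : 𝔼} (hx : ‖x‖ < 2) : ∀ᶠ y in 𝓝 x, Θ y = y := by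
  filter_upwards [(isOpen_lt continuous_norm continuous_const).mem_nhds hx] with y hy using L.hΘid y hy

theorem ev_eta {v η : 𝔼 → ℝ} {Θ : 𝔼 → 𝔼} {x₀ ξ : 𝔼} {ρ₀ r : ℝ} (L : Loc v x₀ ρ₀ η Θ r ξ) {x : 𝔼} (hx : 1 < ‖x‖) : ∀ᶠ y in 𝓝 x, η y = 0 := by
  filter_upwards [(isOpen_lt continuous_const continuous_norm).mem_nhds hx] with y hy using L.hη0 y hy

theorem pd_eta {v η : 𝔼 → ℝ} {Θ : 𝔼 → 𝔼} {x₀ ξ : 𝔼} {ρ₀ r : ℝ} (L : Loc v x₀ ρ₀ η Θ r ξ) {x : 𝔼} (hx : 1 < ‖x‖) (k : Fin n) : pd η k x = 0 := by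
  rw [pd_congr (g := fun _ => (0 : ℝ)) (L.ev_eta hx), pd_const]

theorem h_zero {v η : 𝔼 → ℝ} {Θ : 𝔼 → 𝔼} {x₀ ξ : 𝔼} {ρ₀ r : ℝ} (L : Loc v x₀ ρ₀ η Θ r ξ) {x : 𝔼} (hx : 1 < ‖x‖) : hfun v x₀ η Θ r ξ x = 0 := by
  simp [hfun, L.hη0 x hx]

theorem h_contDiff {v η : 𝔼 → ℝ} {Θ : 𝔼 → 𝔼} {x₀ ξ : 𝔼} {ρ₀ r : ℝ} (L : Loc v x₀ ρ₀ η Θ r ξ) : ContDiff ℝ 2 (hfun v x₀ η Θ r ξ) := by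
  have h1 := L.hv
  have h2 := L.hη
  have h3 := L.hΘ
  unfold hfun
  refine contDiff_const.mul ((h1.comp ?_).sub (h1.comp ?_))
  · fun_prop
  · fun_prop

theorem pd_h {v η : 𝔼 → ℝ} {Θ : 𝔼 → 𝔼} {x₀ ξ : 𝔼} {ρ₀ r : ℝ} (L : Loc v x₀ ρ₀ η Θ r ξ) (x : 𝔼) (k : Fin n) : pd (hfun v x₀ η Θ r ξ) k x =
    pd v k (x₀ + r • (Θ x + η x • ξ)) + pd η k x * (∑ l, ξ l * pd v l (x₀ + r • (Θ x + η x • ξ)))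
      - pd v k (x₀ + r • Θ x) := by
  have hvd := L.hv.differentiable (by norm_num)
  have hηd := L.hη.differentiable (by norm_num)
  have hΘd := L.hΘ.differentiable (by norm_num)
  rcases lt_or_ge ‖x‖ 2 with hx | hx
  · have e : hfun v x₀ η Θ r ξ =ᶠ[𝓝 x] fun x => r⁻¹ * (v (x₀ + r • (x + η x • ξ)) - v (x₀ + r • (x + (fun _ => (0 : ℝ)) x • ξ))) := by
      filter_upwards [L.ev_id hx] with y hy
      simp [hfun, hy]
    rw [pd_congr e]
    have d1 : DifferentiableAt ℝ (fun x : 𝔼 => v (x₀ + r • (x + η x • ξ))) x := by fun_prop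
    have d2 : DifferentiableAt ℝ (fun x : 𝔼 => v (x₀ + r • (x + (fun _ => (0 : ℝ)) x • ξ))) x := by fun_prop
    rw [pd_const_mul _ (d1.fun_sub d2), pd_sub d1 d2, pd_phi (hvd _) (hηd _), pd_phi (hvd _) (differentiableAt_const _), pd_const,
      L.hΘid x hx]
    have := L.hr
    simp only [zero_smul, add_zero, zero_mul]
    field_simp
  · have hx1 : 1 < ‖x‖ := by linarith
    have e : hfun v x₀ η Θ r ξ =ᶠ[𝓝 x] fun _ => 0 := by
      filter_upwards [(isOpen_lt continuous_const continuous_norm).mem_nhds hx1] with y hy using L.h_zero hy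
    rw [pd_congr e, pd_const, L.pd_eta hx1, L.hη0 x hx1]
    simp

/-- the (pulled back) flux difference -/
theorem G_props {v η : 𝔼 → ℝ} {Θ : 𝔼 → 𝔼} {x₀ ξ : 𝔼} {ρ₀ r : ℝ} (L : Loc v x₀ ρ₀ η Θ r ξ) : (∀ j, ContDiff ℝ 1 (fun x => (1 + ∑ i, ξ i * pd η i x) * flux v j (x₀ + r • (Θ x + η x • ξ))
      - ξ j * (∑ k, pd η k x * flux v k (x₀ + r • (Θ x + η x • ξ))) - flux v j (x₀ + r • Θ x))) ∧
    ∀ x, ∑ j, pd (fun x => (1 + ∑ i, ξ i * pd η i x) * flux v j (x₀ + r • (Θ x + η x • ξ))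
      - ξ j * (∑ k, pd η k x * flux v k (x₀ + r • (Θ x + η x • ξ))) - flux v j (x₀ + r • Θ x)) j x = 0 := by
  have cη : ∀ i, ContDiff ℝ 1 (pd η i) := fun i => contDiff_pd L.hη (by norm_num) i
  have cη1 : ContDiff ℝ 1 η := L.hη.of_le (by norm_num)
  have cΘ1 : ContDiff ℝ 1 Θ := L.hΘ.of_le (by norm_num)
  have cφ : ContDiff ℝ 1 (fun x => x₀ + r • (Θ x + η x • ξ)) :=
    by fun_prop
  have cφ0 : ContDiff ℝ 1 (fun x => x₀ + r • Θ x) :=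
    by fun_prop
  have cF : ∀ j, ContDiff ℝ 1 (fun x => flux v j (x₀ + r • (Θ x + η x • ξ))) := fun j =>
    contDiff_iff_contDiffAt.2 fun x => ContDiffAt.fun_comp x (flux_contDiffAt L.hv (L.hpos _ (L.hφ x)) j) cφ.contDiffAt
  have cF0 : ∀ j, ContDiff ℝ 1 (fun x => flux v j (x₀ + r • Θ x)) := fun j =>
    contDiff_iff_contDiffAt.2 fun x => ContDiffAt.fun_comp x (flux_contDiffAt L.hv (L.hpos _ (L.hφ0 x)) j) cφ0.contDiffAt
  have cT : ∀ j, ContDiff ℝ 1 (fun x => (1 + ∑ i, ξ i * pd η i x) * flux v j (x₀ + r • (Θ x + η x • ξ))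
      - ξ j * (∑ k, pd η k x * flux v k (x₀ + r • (Θ x + η x • ξ)))) := fun j =>
    ((contDiff_const.add (ContDiff.sum fun i _ => contDiff_const.mul (cη i))).mul (cF j)).sub
      (contDiff_const.mul (ContDiff.sum fun k _ => (cη k).mul (cF k)))
  refine ⟨fun j => (cT j).sub (cF0 j), fun x => ?_⟩
  have hsplit : ∀ j, pd (fun x => (1 + ∑ i, ξ i * pd η i x) * flux v j (x₀ + r • (Θ x + η x • ξ))
      - ξ j * (∑ k, pd η k x * flux v k (x₀ + r • (Θ x + η x • ξ))) - flux v j (x₀ + r • Θ x)) j x =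
      pd (fun x => (1 + ∑ i, ξ i * pd η i x) * flux v j (x₀ + r • (Θ x + η x • ξ))
      - ξ j * (∑ k, pd η k x * flux v k (x₀ + r • (Θ x + η x • ξ)))) j x - pd (fun x => flux v j (x₀ + r • Θ x)) j x := fun j =>
    pd_sub ((cT j).differentiable (by norm_num) x) ((cF0 j).differentiable (by norm_num) x) j
  rcases lt_or_ge ‖x‖ 2 with hx | hx
  · simp_rw [hsplit]
    rw [Finset.sum_sub_distrib]
    have hid := L.hΘid x hx
    have b1 := L.hφ x
    have b0 := L.hφ0 x
    rw [hid] at b1 b0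
    have e1 : ∀ j, pd (fun x => (1 + ∑ i, ξ i * pd η i x) * flux v j (x₀ + r • (Θ x + η x • ξ))
      - ξ j * (∑ k, pd η k x * flux v k (x₀ + r • (Θ x + η x • ξ)))) j x =
      pd (fun x => (1 + ∑ i, ξ i * pd η i x) * flux v j (x₀ + r • (x + η x • ξ))
      - ξ j * (∑ k, pd η k x * flux v k (x₀ + r • (x + η x • ξ)))) j x := fun j =>
      pd_congr (by filter_upwards [L.ev_id hx] with y hy; simp only [hy]) j
    have e2 : ∀ j, pd (fun x => flux v j (x₀ + r • Θ x)) j x = r * pd (flux v j) j (x₀ + r • x) := by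
      intro j
      have e3 : pd (fun x => flux v j (x₀ + r • Θ x)) j x =
          pd (fun x => flux v j (x₀ + r • (x + (fun _ => (0 : ℝ)) x • ξ))) j x :=
        pd_congr (by filter_upwards [L.ev_id hx] with y hy; simp [hy]) j
      rw [e3, pd_phi (by
        simp only [zero_smul, add_zero]
        exact (flux_contDiffAt L.hv (L.hpos _ b0) j).differentiableAt (by norm_num)) (differentiableAt_const _), pd_const]
      simp
    simp_rw [e1, e2]
    rw [piola (fun i => (flux_contDiffAt L.hv (L.hpos _ b1) i).differentiableAt (by norm_num)) L.hη, ← Finset.mul_sum]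
    have z1 : ∑ j, pd (flux v j) j (x₀ + r • (x + η x • ξ)) = 0 := L.hdiv _ b1
    have z2 : ∑ j, pd (flux v j) j (x₀ + r • x) = 0 := L.hdiv _ b0
    rw [z1, z2]; simp
  · have hx1 : 1 < ‖x‖ := by linarith
    refine Finset.sum_eq_zero fun j _ => ?_
    rw [pd_congr (g := fun _ => (0 : ℝ)) (by
      filter_upwards [(isOpen_lt continuous_const continuous_norm).mem_nhds hx1] with y hy
      simp [L.hη0 y hy, L.pd_eta hy]), pd_const]

end Loc
end
end RH
end


section
open Real Set MeasureTheory Filter Topology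
namespace RH
section
variable {n : ℕ}
local notation "𝔼" => EuclideanSpace ℝ (Fin n)

theorem ftc_line {h : 𝔼 → ℝ} (hh : ContDiff ℝ 2 h) (i : Fin n) (x : 𝔼) :
    ∫ t in (0 : ℝ)..4, pd h i (x + t • EuclideanSpace.single i (1 : ℝ)) =
      h (x + (4 : ℝ) • EuclideanSpace.single i (1 : ℝ)) - h x := by
  have hc : Continuous (pd h i) := (contDiff_pd hh (l := 1) (by norm_num) i).continuous
  have := intervalIntegral.integral_eq_sub_of_hasDerivAt (a := 0) (b := 4)
    (f := fun t : ℝ => h (x + t • EuclideanSpace.single i (1 : ℝ)))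
    (f' := fun t : ℝ => pd h i (x + t • EuclideanSpace.single i (1 : ℝ))) (fun t _ => by
      have h1 : HasDerivAt (fun t : ℝ => x + t • EuclideanSpace.single i (1 : ℝ)) (EuclideanSpace.single i (1 : ℝ)) t := by
        simpa using ((hasDerivAt_id t).smul_const (EuclideanSpace.single i (1 : ℝ))).const_add x
      exact ((hh.differentiable (by norm_num)) _).hasFDerivAt.comp_hasDerivAt t h1)
    (Continuous.intervalIntegrable (by fun_prop) _ _)
  rw [this]; simp

theorem fixed_point {v η : 𝔼 → ℝ} {Θ : 𝔼 → 𝔼} {x₀ ξ : 𝔼} {ρ₀ r : ℝ} (L : Loc v x₀ ρ₀ η Θ r ξ)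
    (d : Dat n) (hz : d.z₀ = v x₀) (hp : ∀ i, d.p i = pd v i x₀) (hηd : ∀ i x, d.ηd i x = pd η i x)
    (hχ1 : ∀ x, ‖x‖ ≤ 1 → d.χ x = 1) (hχ2 : ∀ x, 2 ≤ ‖x‖ → d.χ x = 0)
    (hAv : ∀ f x, d.Av f x = ∫ t in (0 : ℝ)..4, f (x + t • EuclideanSpace.single d.i₀ (1 : ℝ)))
    {m ρ : 𝔼 → ℝ} {c₀ S : ℝ}
    (hm : ContDiff ℝ 3 m) (hc : HasCompactSupport m)
    (hρ : Continuous ρ) (hρc : HasCompactSupport ρ)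
    (hρm : ∀ z i, ρ z * z i = ∑ j, d.a i j * pd m j z) (hρ0 : ∀ z, ‖z‖ < c₀ → ρ z = 0)
    (hS : 0 ≤ S) (hSc : 3 < S ^ 2 * c₀) (hρi : ∫ z, ρ z ≠ 0) (hdc : d.c = ∫ z, ρ z)
    (hJ : ∀ k j f x, d.J k j f x = ∫ s in (0 : ℝ)..S, 2 / s * Mop (pd (pd m j) k) s f x)
    (q : Par n × Unk n) (hq1 : q.1.1 = ξ) (hq2 : q.1.2.1 = r)
    (hU : ∀ x, q.1.2.2.1 x = v (x₀ + r • Θ x) - v x₀)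
    (hP : ∀ i x, q.1.2.2.2 i x = pd v i (x₀ + r • Θ x) - pd v i x₀)
    (hg : ∀ k x, q.2 k x = pd (hfun v x₀ η Θ r ξ) k x)
    (h1 : ∀ j x, d.N (d.ww q) (d.qq q) j x = d.ww q x * d.qq q j x / √((d.ww q x) ^ 2 + ∑ i, (d.qq q i x) ^ 2))
    (h2 : ∀ j x, d.N (d.U1 q) (d.P1 q) j x = d.U1 q x * d.P1 q j x / √((d.U1 q x) ^ 2 + ∑ i, (d.P1 q i x) ^ 2))
    (h3 : ∀ x, (1 + d.tt q x) * (Ring.inverse (1 + d.tt q)) x = 1) :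
    q.2 = d.Phi q ∧ d.Av (q.2 d.i₀) 0 = - hfun v x₀ η Θ r ξ 0 := by
  have hh := L.h_contDiff
  have av : ∀ x, ‖x‖ < 2 → d.Av (q.2 d.i₀) x = - hfun v x₀ η Θ r ξ x := by
    intro x hx
    rw [hAv]
    simp_rw [hg]
    rw [ftc_line hh, L.h_zero, zero_sub]
    have e1 : ‖(4 : ℝ) • EuclideanSpace.single d.i₀ (1 : ℝ)‖ = 4 := by
      rw [norm_smul]; simp
    have e2 := norm_sub_le (x + (4 : ℝ) • EuclideanSpace.single d.i₀ (1 : ℝ)) x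
    rw [add_sub_cancel_left, e1] at e2
    linarith
  refine ⟨?_, av 0 (by simp)⟩
  have tt : ∀ x, d.tt q x = ∑ i, ξ i * pd η i x := by
    intro x
    simp [Dat.tt, Hol.sum_apply, hq1, hηd]
  have u1 : ∀ x, d.U1 q x = v (x₀ + r • Θ x) := by
    intro x; simp [Dat.U1, hU, hz]
  have p1 : ∀ i x, d.P1 q i x = pd v i (x₀ + r • Θ x) := by
    intro i x; simp [Dat.P1, hP, hp]
  have ww : ∀ x, d.ww q x = v (x₀ + r • (Θ x + η x • ξ)) := by
    intro x
    have key : d.χ x * d.Av (q.2 d.i₀) x = - hfun v x₀ η Θ r ξ x := by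
      rcases le_or_gt ‖x‖ 1 with hx | hx
      · rw [hχ1 x hx, av x (by linarith), one_mul]
      · rcases lt_or_ge ‖x‖ 2 with hx' | hx'
        · rw [av x hx', L.h_zero hx]; simp
        · rw [hχ2 x hx', L.h_zero hx]; simp
    have : d.ww q x = d.U1 q x - r * (d.χ x * d.Av (q.2 d.i₀) x) := by simp [Dat.ww, hq2]
    rw [this, key, u1, hfun]
    have := L.hr
    field_simp
    ring
  have QQ : ∀ k x, d.QQ q k x = pd v k (x₀ + r • (Θ x + η x • ξ)) + pd η k x * (∑ l, ξ l * pd v l (x₀ + r • (Θ x + η x • ξ))) := by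
    intro k x
    simp only [Dat.QQ, Hol.add_apply, p1, hg, L.pd_h]
    ring
  have qq : ∀ k x, d.qq q k x = pd v k (x₀ + r • (Θ x + η x • ξ)) := by
    intro k x
    have e : ∑ l, ξ l * d.QQ q l x = (1 + d.tt q x) * ∑ l, ξ l * pd v l (x₀ + r • (Θ x + η x • ξ)) := by
      simp_rw [QQ, tt, mul_add, Finset.sum_add_distrib, add_mul, one_mul, Finset.sum_mul]
      congr 1
      exact Finset.sum_congr rfl fun l _ => by ring
    have e2 : d.qq q k x = d.QQ q k x - d.ηd k x * (∑ l, ξ l * d.QQ q l x) * (Ring.inverse (1 + d.tt q)) x := by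
      simp [Dat.qq, hq1, Hol.sum_apply]
    rw [e2, e, QQ, hηd]
    have := h3 x
    linear_combination (- pd η k x * ∑ l, ξ l * pd v l (x₀ + r • (Θ x + η x • ξ))) * this
  have n1 : ∀ j x, d.N (d.ww q) (d.qq q) j x = flux v j (x₀ + r • (Θ x + η x • ξ)) := by
    intro j x; rw [h1]; simp_rw [ww, qq]; rfl
  have n2 : ∀ j x, d.N (d.U1 q) (d.P1 q) j x = flux v j (x₀ + r • Θ x) := by
    intro j x; rw [h2]; simp_rw [u1, p1]; rfl
  have gg : ∀ j x, d.GG q j x = (1 + ∑ i, ξ i * pd η i x) * flux v j (x₀ + r • (Θ x + η x • ξ))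
      - ξ j * (∑ k, pd η k x * flux v k (x₀ + r • (Θ x + η x • ξ))) - flux v j (x₀ + r • Θ x) := by
    intro j x
    simp [Dat.GG, Hol.sum_apply, n1, n2, tt, hq1, hηd]
  obtain ⟨G1, G2⟩ := L.G_props
  have gz : ∀ k x s, ∑ j, Mop (pd (pd m j) k) s (d.GG q j) x = 0 := by
    intro k x s
    have := divfree_zero hm hc G1 G2 s k x
    rw [← this]
    refine Finset.sum_congr rfl fun j _ => ?_
    congr 1
    funext y; exact gg j y
  have ker : ∀ k j, ∃ R B L, Ker (pd (pd m j) k) R B L := fun k j =>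
    ker_pd (contDiff_pd hm (by norm_num) j) (hasCompactSupport_pd hc j) k
  have jsum : ∀ (F : Fin n → Hol 𝔼) k x, ∑ j, d.J k j (F j) x = ∫ s in (0 : ℝ)..S, 2 / s * ∑ j, Mop (pd (pd m j) k) s (F j) x := by
    intro F k x
    simp_rw [hJ, Finset.mul_sum]
    rw [intervalIntegral.integral_finsetSum]
    intro j _
    obtain ⟨R, B, L', hk⟩ := ker k j
    exact hk.J_intble S hS (F j) x
  funext k
  ext x
  have ph : d.Phi q k x = d.c⁻¹ * (d.χ x * ((∑ j, d.J k j (∑ i, d.a i j • q.2 i) x) - ∑ j, d.J k j (d.GG q j) x)) := by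
    simp only [Dat.Phi, Hol.smul_apply, Hol.mul_apply, Hol.sum_apply, map_sub, Hol.sub_apply, Finset.sum_sub_distrib]
  rw [ph, hg]
  rcases lt_or_ge ‖x‖ 2 with hx | hx
  · rw [jsum (fun j => ∑ i, d.a i j • q.2 i), jsum (d.GG q)]
    simp_rw [gz]
    have e : ∀ s, ∑ j, Mop (pd (pd m j) k) s (⇑(∑ i, d.a i j • q.2 i)) x =
       ∑ j, Mop (pd (pd m j) k) s (fun y => ∑ i, d.a i j * pd (hfun v x₀ η Θ r ξ) i y) x := by
      intro s
      refine Finset.sum_congr rfl fun j _ => ?_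
      congr 1
      funext y
      simp [Hol.sum_apply, hg]
    simp_rw [e]
    rw [← repro hm hc hρ hρc hρm hρ0 hS hSc hh (fun x hx => L.h_zero hx) k x hx.le, hdc]
    simp only [mul_zero, intervalIntegral.integral_zero, sub_zero]
    rcases le_or_gt ‖x‖ 1 with hx1 | hx1
    · rw [hχ1 x hx1]; field_simp
    · have : pd (hfun v x₀ η Θ r ξ) k x = 0 := by
        rw [L.pd_h, L.pd_eta hx1, L.hη0 x hx1]; simp
      rw [this]; simp
  · have hx1 : 1 < ‖x‖ := by linarith
    rw [hχ2 x hx, L.pd_h, L.pd_eta hx1, L.hη0 x hx1]; simp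
end
end RH
end


section
open Real Set MeasureTheory Filter Topology
namespace RH
section
variable {n : ℕ}
local notation "𝔼" => EuclideanSpace ℝ (Fin n)

/-- bounded and Lipschitz with a common constant -/
def BL {E : Type} [NormedAddCommGroup E] {F : Type} [NormedAddCommGroup F] (f : E → F) (C : ℝ) : Prop :=
  0 ≤ C ∧ (∀ x, ‖f x‖ ≤ C) ∧ ∀ x y, ‖f x - f y‖ ≤ C * dist x y

theorem exists_BL {F : Type} [NormedAddCommGroup F] [NormedSpace ℝ F] {f : 𝔼 → F} (hf : ContDiff ℝ 1 f) (hc : HasCompactSupport f) :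
    ∃ C, BL f C := by
  obtain ⟨B, hB⟩ := hc.exists_bound_of_continuous hf.continuous
  obtain ⟨K, hK⟩ := hf.lipschitzWith_of_hasCompactSupport hc (by norm_num)
  have hB0 : 0 ≤ B := (norm_nonneg _).trans (hB 0)
  refine ⟨B + K, by positivity, fun x => (hB x).trans (by simp), fun x y => ?_⟩
  rw [← dist_eq_norm]
  refine (hK.dist_le_mul x y).trans ?_
  exact mul_le_mul_of_nonneg_right (by linarith) dist_nonneg

theorem exists_hol {f : 𝔼 → ℝ} (hf : ContDiff ℝ 1 f) (hc : HasCompactSupport f) :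
    ∃ F : Hol 𝔼, ∀ x, F x = f x := by
  obtain ⟨C, h0, h1, h2⟩ := exists_BL hf hc
  obtain ⟨F, hF, _⟩ := Hol.exists_of_lip f h0 h1 h2
  exact ⟨F, hF⟩

theorem small_delta {f : 𝔼 → ℝ} {Θ : 𝔼 → 𝔼} {C M : ℝ} (hf : BL f C) (hΘ : BL Θ M) (x₀ : 𝔼) {r : ℝ} (hr : 0 < r) :
    ∃ F : Hol 𝔼, (∀ x, F x = f (x₀ + r • Θ x) - f x₀) ∧ ‖F‖ ≤ 3 * C * M * r := by
  obtain ⟨hC, _, hf2⟩ := hf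
  obtain ⟨hM, hΘ1, hΘ2⟩ := hΘ
  obtain ⟨F, hF, hn⟩ := Hol.exists_of_lip (fun x => f (x₀ + r • Θ x) - f x₀) (σ := C * M * r) (L := C * M * r) (by positivity)
    (fun x => by
      refine (hf2 _ _).trans ?_
      rw [dist_eq_norm, add_sub_cancel_left, norm_smul, Real.norm_of_nonneg hr.le, mul_assoc, mul_comm M]
      have := hΘ1 x
      gcongr)
    (fun x y => by
      rw [sub_sub_sub_cancel_right]
      refine (hf2 _ _).trans ?_
      rw [dist_eq_norm, add_sub_add_left_eq_sub, ← smul_sub, norm_smul, Real.norm_of_nonneg hr.le]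
      calc C * (r * ‖Θ x - Θ y‖) ≤ C * (r * (M * dist x y)) := by have := hΘ2 x y; gcongr
        _ = _ := by ring)
  refine ⟨F, hF, hn.trans ?_⟩
  have : √(2 * (C * M * r) * (C * M * r)) ≤ 2 * (C * M * r) := by
    rw [Real.sqrt_le_left (by positivity)]
    nlinarith [sq_nonneg (C * M * r)]
  linarith

theorem phi_lip {η : 𝔼 → ℝ} {Θ : 𝔼 → 𝔼} {M E : ℝ} (hΘ : BL Θ M) (hη : BL η E) (x₀ ξ : 𝔼) (hξ : ‖ξ‖ ≤ 1) {r : ℝ} (hr : 0 < r) (x y : 𝔼) :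
    dist (x₀ + r • (Θ x + η x • ξ)) (x₀ + r • (Θ y + η y • ξ)) ≤ r * (M + E) * dist x y := by
  rw [dist_eq_norm, add_sub_add_left_eq_sub, ← smul_sub, norm_smul, Real.norm_of_nonneg hr.le, mul_assoc]
  refine mul_le_mul_of_nonneg_left ?_ hr.le
  have e : Θ x + η x • ξ - (Θ y + η y • ξ) = (Θ x - Θ y) + (η x - η y) • ξ := by module
  rw [e, add_mul]
  refine (norm_add_le _ _).trans (add_le_add (hΘ.2.2 x y) ?_)
  rw [norm_smul]
  have h1 := hη.2.2 x y
  have h2 := norm_nonneg (η x - η y)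
  nlinarith [norm_nonneg ξ]

theorem small_g_one {f : Fin n → 𝔼 → ℝ} {η : 𝔼 → ℝ} {Θ : 𝔼 → 𝔼} {C : ℝ} {M E : ℝ} (hf : ∀ i, BL (f i) C)
    (hΘ : BL Θ M) (hη : BL η E) (ηd : Fin n → Hol 𝔼) (x₀ : 𝔼) {r : ℝ} (hr : 0 < r) (k : Fin n) :
    ∃ K1 K2 : ℝ, ∀ ξ : 𝔼, ‖ξ‖ ≤ 1 → ∃ g : Hol 𝔼, (∀ x, g x = f k (x₀ + r • (Θ x + η x • ξ)) +
      ηd k x * (∑ l, ξ l * f l (x₀ + r • (Θ x + η x • ξ))) - f k (x₀ + r • Θ x)) ∧ ‖g‖ ≤ K1 * ‖ξ‖ + √(K2 * ‖ξ‖) := by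
  have hC := (hf k).1
  have hM := hΘ.1
  have hE := hη.1
  set B := C + √(2 * C * (C * (r * (M + E)))) with hB
  have hB0 : 0 ≤ B := by positivity
  refine ⟨C * r * E + ‖ηd k‖ * (n * B), 2 * (C * r * E) * (C * (2 * (r * (M + E)))), fun ξ hξ => ?_⟩
  have hF : ∀ l, ∃ F : Hol 𝔼, (∀ x, F x = f l (x₀ + r • (Θ x + η x • ξ))) ∧ ‖F‖ ≤ B := fun l =>
    Hol.exists_of_lip (fun x => f l (x₀ + r • (Θ x + η x • ξ))) hC (fun x => (hf l).2.1 _) (fun x y => by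
      refine ((hf l).2.2 _ _).trans ?_
      rw [mul_assoc]
      exact mul_le_mul_of_nonneg_left (phi_lip hΘ hη x₀ ξ hξ hr x y) hC)
  choose F hFx hFn using hF
  have hl0 : ∀ x y, dist (x₀ + r • Θ x) (x₀ + r • Θ y) ≤ r * (M + E) * dist x y := by
    intro x y
    have := phi_lip hΘ hη x₀ 0 (by simp) hr x y
    simpa using this
  obtain ⟨D, hD, hDn⟩ := Hol.exists_of_lip (fun x => f k (x₀ + r • (Θ x + η x • ξ)) - f k (x₀ + r • Θ x))
    (σ := C * r * E * ‖ξ‖) (L := C * (2 * (r * (M + E)))) (by positivity)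
    (fun x => by
      refine ((hf k).2.2 _ _).trans ?_
      rw [dist_eq_norm, add_sub_add_left_eq_sub, ← smul_sub, add_sub_cancel_left, norm_smul, norm_smul, Real.norm_of_nonneg hr.le]
      have := hη.2.1 x
      calc C * (r * (‖η x‖ * ‖ξ‖)) ≤ C * (r * (E * ‖ξ‖)) := by gcongr
        _ = _ := by ring)
    (fun x y => by
      have a1 := ((hf k).2.2 (x₀ + r • (Θ x + η x • ξ)) (x₀ + r • (Θ y + η y • ξ))).trans
        (mul_le_mul_of_nonneg_left (phi_lip hΘ hη x₀ ξ hξ hr x y) hC)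
      have a2 := ((hf k).2.2 (x₀ + r • Θ x) (x₀ + r • Θ y)).trans
        (mul_le_mul_of_nonneg_left (hl0 x y) hC)
      rw [Real.norm_eq_abs] at a1 a2
      rw [abs_le] at *
      constructor <;> linarith)
  refine ⟨D + ηd k * ∑ l, ξ l • F l, fun x => ?_, ?_⟩
  · simp only [Hol.add_apply, Hol.mul_apply, Hol.sum_apply, Hol.smul_apply, hD, hFx]; ring
  · have s1 : ‖∑ l, ξ l • F l‖ ≤ n * B * ‖ξ‖ := by
      refine (norm_sum_le _ _).trans ?_
      have : ∀ l ∈ Finset.univ, ‖ξ l • F l‖ ≤ ‖ξ‖ * B := fun l _ => by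
        rw [norm_smul]
        exact mul_le_mul (PiLp.norm_apply_le ξ l) (hFn l) (norm_nonneg _) (norm_nonneg _)
      refine (Finset.sum_le_sum this).trans ?_
      simp; linarith
    have s2 : ‖ηd k * ∑ l, ξ l • F l‖ ≤ ‖ηd k‖ * (n * B * ‖ξ‖) :=
      (norm_mul_le _ _).trans (mul_le_mul_of_nonneg_left s1 (norm_nonneg _))
    have s3 : 2 * (C * r * E * ‖ξ‖) * (C * (2 * (r * (M + E)))) = 2 * (C * r * E) * (C * (2 * (r * (M + E)))) * ‖ξ‖ := by ring
    rw [s3] at hDn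
    refine (norm_add_le _ _).trans ?_
    linarith

theorem small_g {f : Fin n → 𝔼 → ℝ} {η : 𝔼 → ℝ} {Θ : 𝔼 → 𝔼} {C : ℝ} {M E : ℝ} (hf : ∀ i, BL (f i) C)
    (hΘ : BL Θ M) (hη : BL η E) (ηd : Fin n → Hol 𝔼) (x₀ : 𝔼) {r : ℝ} (hr : 0 < r) {ε : ℝ} (hε : 0 < ε) :
    ∀ᶠ ξ : 𝔼 in 𝓝 0, ∃ g : Unk n, (∀ k x, g k x = f k (x₀ + r • (Θ x + η x • ξ)) +
      ηd k x * (∑ l, ξ l * f l (x₀ + r • (Θ x + η x • ξ))) - f k (x₀ + r • Θ x)) ∧ ‖g‖ < ε := by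
  choose K1 K2 h using small_g_one hf hΘ hη ηd x₀ hr
  have ht : ∀ k, ∀ᶠ ξ : 𝔼 in 𝓝 0, K1 k * ‖ξ‖ + √(K2 k * ‖ξ‖) < ε := by
    intro k
    have : Continuous fun ξ : 𝔼 => K1 k * ‖ξ‖ + √(K2 k * ‖ξ‖) := by fun_prop
    refine this.continuousAt.eventually_lt continuousAt_const ?_
    simpa using hε
  filter_upwards [eventually_all.2 ht, Metric.ball_mem_nhds (0 : 𝔼) one_pos] with ξ h1 h2
  have h3 : ‖ξ‖ ≤ 1 := by simpa using (mem_ball_zero_iff.1 h2).le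
  choose g hg1 hg2 using fun k => h k ξ h3
  exact ⟨g, hg1, (pi_norm_lt_iff hε).2 fun k => (hg2 k).trans_lt (h1 k)⟩
end
end RH
end


section
open Real Set MeasureTheory Filter Topology
namespace RH
section
variable {n : ℕ}
local notation "𝔼" => EuclideanSpace ℝ (Fin n)



theorem core {v : 𝔼 → ℝ} {x₀ : 𝔼} {ρ₀ : ℝ} (hρ₀ : 0 < ρ₀) (i₀ : Fin n) (hv : ContDiff ℝ 2 v) (hvc : HasCompactSupport v)
    (hpos : ∀ x ∈ Metric.ball x₀ ρ₀, 0 < v x) (hdiv : ∀ x ∈ Metric.ball x₀ ρ₀, relDiv v x = 0) :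
    AnalyticAt ℝ v x₀ := by
  -- cut-offs
  let bη : ContDiffBump (0 : 𝔼) := ⟨1 / 2, 1, by norm_num, by norm_num⟩
  let bχ : ContDiffBump (0 : 𝔼) := ⟨1, 2, by norm_num, by norm_num⟩
  let bΘ : ContDiffBump (0 : 𝔼) := ⟨2, 3, by norm_num, by norm_num⟩
  set η : 𝔼 → ℝ := fun x => bη x with hη
  set Θ : 𝔼 → 𝔼 := fun x => bΘ x • x with hΘ
  have cη : ContDiff ℝ 2 η := bη.contDiff
  have sη : HasCompactSupport η := bη.hasCompactSupport
  have cχ : ContDiff ℝ 1 (fun x => bχ x) := bχ.contDiff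
  have cΘ : ContDiff ℝ 2 Θ := by
    have : ContDiff ℝ 2 (fun x => bΘ x) := bΘ.contDiff
    exact this.smul contDiff_id
  have sΘ : HasCompactSupport Θ := bΘ.hasCompactSupport.smul_right
  have η0 : ∀ x, 1 < ‖x‖ → η x = 0 := fun x hx => bη.zero_of_le_dist (by simpa using hx.le)
  have η1 : η 0 = 1 := bη.one_of_mem_closedBall (by simp [bη])
  have Θid : ∀ x, ‖x‖ < 2 → Θ x = x := fun x hx => by
    have : bΘ x = 1 := bΘ.one_of_mem_closedBall (by simpa using hx.le)
    simp [hΘ, this]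
  obtain ⟨M, hM⟩ := exists_BL (cΘ.of_le (by norm_num)) sΘ
  obtain ⟨E, hE⟩ := exists_BL (cη.of_le (by norm_num)) sη
  -- bounds for v and its derivatives
  obtain ⟨C0, hC0⟩ := exists_BL (hv.of_le (by norm_num)) hvc
  have cpd : ∀ i, ContDiff ℝ 1 (pd v i) := fun i => contDiff_pd hv (by norm_num) i
  choose C1 hC1 using fun i => exists_BL (cpd i) (hasCompactSupport_pd hvc i)
  have hC10 : ∀ i, 0 ≤ C1 i := fun i => (hC1 i).1
  set C := ∑ i, C1 i with hC
  have hCf : ∀ i, BL (pd v i) C := fun i => by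
    have hle : C1 i ≤ C := Finset.single_le_sum (f := C1) (fun i _ => hC10 i) (Finset.mem_univ i)
    exact ⟨(hC10 i).trans hle, fun x => ((hC1 i).2.1 x).trans hle, fun x y => ((hC1 i).2.2 x y).trans
      (mul_le_mul_of_nonneg_right hle dist_nonneg)⟩
  -- base point
  have hz : 0 < v x₀ := hpos x₀ (Metric.mem_ball_self hρ₀)
  have hsum : 0 ≤ ∑ i, (pd v i x₀) ^ 2 := Finset.sum_nonneg fun i _ => sq_nonneg _
  set s₀ := √((v x₀) ^ 2 + ∑ i, (pd v i x₀) ^ 2) with hs₀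
  have hs : 0 < s₀ := Real.sqrt_pos.2 (by positivity)
  have hsz : s₀ ^ 2 = (v x₀) ^ 2 + ∑ i, (pd v i x₀) ^ 2 := Real.sq_sqrt (by positivity)
  obtain ⟨R, hR1, hR2, hR3, hR4⟩ := exists_isq (E := 𝔼) hs
  set a : Fin n → Fin n → ℝ := fun i j => v x₀ / s₀ * ((if i = j then 1 else 0) - pd v i x₀ * pd v j x₀ / s₀ ^ 2) with ha
  obtain ⟨m, ρ, c₀, hc₀, hm, hmc, hρ, hρc, hρm, hρ0, hρi⟩ := kernel_exists i₀ hz hs (fun i => pd v i x₀) hsz a (fun i j => rfl)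
  obtain ⟨S, hS, hSc⟩ : ∃ S : ℝ, 0 ≤ S ∧ 3 < S ^ 2 * c₀ := by
    refine ⟨√(4 / c₀), Real.sqrt_nonneg _, ?_⟩
    rw [Real.sq_sqrt (by positivity), div_mul_cancel₀ _ hc₀.ne']
    norm_num
  have hJ : ∀ k j, ∃ J : Hol 𝔼 →L[ℝ] Hol 𝔼, ∀ f x, J f x = ∫ s in (0 : ℝ)..S, 2 / s * Mop (pd (pd m j) k) s f x := by
    intro k j
    obtain ⟨R', B, L, hk⟩ := ker_pd (contDiff_pd hm (l := 2) (by norm_num) j) (hasCompactSupport_pd hmc j) k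
    exact hk.exists_J S hS
  choose J hJ using hJ
  obtain ⟨Av, hAv⟩ := exists_avg (EuclideanSpace.single i₀ (1 : ℝ) : 𝔼)
  choose ηd hηd using fun i => exists_hol (contDiff_pd cη (l := 1) (by norm_num) i) (hasCompactSupport_pd sη i)
  obtain ⟨χ, hχ⟩ := exists_hol cχ bχ.hasCompactSupport
  let d : Dat n := ⟨i₀, v x₀, s₀, fun i => pd v i x₀, a, R, ηd, χ, Av, J, ∫ z, ρ z⟩
  have hd : d.Good := ⟨hs, hsz, fun i j => rfl, hR1, hR2, hR3, hR4⟩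
  obtain ⟨ψ, hψ⟩ := hd.exists_psi
  obtain ⟨ε, hε, hball⟩ := Metric.eventually_nhds_iff_ball.1 (hψ.and hd.eventually_pw)
  -- choice of r
  obtain ⟨r, hr, hr1, hr2, hr3, hr4⟩ : ∃ r : ℝ, 0 < r ∧ r < ε ∧ 3 * C0 * M * r < ε ∧ 3 * C * M * r < ε ∧ (M + E) * r < ρ₀ := by
    have key : ∀ (A B : ℝ), 0 < B → ∀ᶠ r in 𝓝[>] (0 : ℝ), A * r < B := fun A B hB => by
      refine eventually_nhdsWithin_of_eventually_nhds ?_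
      have : Continuous fun r : ℝ => A * r := by fun_prop
      exact this.continuousAt.eventually_lt continuousAt_const (by simpa using hB)
    obtain ⟨r, h1, h2, h3, h4, h5⟩ := (eventually_mem_nhdsWithin.and ((key 1 ε hε).and ((key (3 * C0 * M) ε hε).and
      ((key (3 * C * M) ε hε).and (key (M + E) ρ₀ hρ₀))))).exists
    exact ⟨r, h1, by simpa using h2, h3, h4, h5⟩
  obtain ⟨δU, hδU, hδUn⟩ := small_delta hC0 hM x₀ hr
  choose δP hδP hδPn using fun i => small_delta (hCf i) hM x₀ hr
  have hδPn' : ‖δP‖ < ε := (pi_norm_lt_iff hε).2 fun i => (hδPn i).trans_lt hr3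
  have hδUn' : ‖δU‖ < ε := hδUn.trans_lt hr2
  have hrn : ‖r‖ < ε := by rwa [Real.norm_of_nonneg hr.le]
  -- the main representation
  have rep : ∀ᶠ ξ : 𝔼 in 𝓝 0, v (x₀ + r • ξ) = v x₀ - r * Av (ψ (ξ, r, δU, δP) i₀) 0 := by
    filter_upwards [small_g hCf hM hE ηd x₀ hr hε, Metric.ball_mem_nhds (0 : 𝔼) one_pos, Metric.ball_mem_nhds (0 : 𝔼) hε]
      with ξ ⟨g, hg, hgn⟩ hξ1 hξε
    have hξ1' : ‖ξ‖ ≤ 1 := (mem_ball_zero_iff.1 hξ1).le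
    have hin : ∀ x, ‖Θ x + η x • ξ‖ ≤ M + E := fun x => by
      refine (norm_add_le _ _).trans (add_le_add (hM.2.1 x) ?_)
      rw [norm_smul]
      have h1 := hE.2.1 x
      have h2 := norm_nonneg (η x)
      nlinarith [norm_nonneg ξ]
    have hin0 : ∀ x, ‖Θ x‖ ≤ M + E := fun x => (hM.2.1 x).trans (by linarith [hE.1])
    have toball : ∀ y : 𝔼, ‖y‖ ≤ M + E → x₀ + r • y ∈ Metric.ball x₀ ρ₀ := fun y hy => by
      rw [mem_ball_iff_norm, add_sub_cancel_left, norm_smul, Real.norm_of_nonneg hr.le]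
      nlinarith
    have L : Loc v x₀ ρ₀ η Θ r ξ :=
      ⟨hv, cη, η0, cΘ, Θid, hr.ne', fun x => toball _ (hin x), fun x => toball _ (hin0 x), hpos, hdiv⟩
    set q : Par n × Unk n := ((ξ, r, δU, δP), g) with hq
    have hqb : q ∈ Metric.ball (0 : Par n × Unk n) ε := by
      rw [mem_ball_zero_iff, Prod.norm_def, Prod.norm_def, Prod.norm_def, Prod.norm_def]
      exact max_lt (max_lt (mem_ball_zero_iff.1 hξε) (max_lt hrn (max_lt hδUn' hδPn'))) hgn
    obtain ⟨⟨-, hfix⟩, h1, h2, h3⟩ := hball q hqb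
    have hgp : ∀ k x, q.2 k x = pd (hfun v x₀ η Θ r ξ) k x := fun k x => by
      rw [L.pd_h]
      have := hg k x
      rw [hηd] at this
      exact this
    obtain ⟨f1, f2⟩ := fixed_point L d rfl (fun _ => rfl) hηd
      (fun x hx => (hχ x).trans (bχ.one_of_mem_closedBall (by simpa using hx)))
      (fun x hx => (hχ x).trans (bχ.zero_of_le_dist (by simpa using hx))) hAv hm hmc hρ hρc hρm hρ0 hS hSc hρi rfl hJ
      q rfl rfl hδU hδP hgp h1 h2 h3
    have f3 := hfix f1
    have f4 : Av (ψ (ξ, r, δU, δP) i₀) 0 = - hfun v x₀ η Θ r ξ 0 := by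
      rw [← f2, f3]
    rw [f4, hfun, η1, Θid 0 (by simp)]
    simp only [one_smul, zero_add, smul_zero, add_zero]
    field_simp
    ring
  -- analyticity
  have hψ0 : AnalyticAt ℝ ψ ((0 : 𝔼), r, δU, δP) := by
    have hqb : ((((0 : 𝔼), r, δU, δP), 0) : Par n × Unk n) ∈ Metric.ball (0 : Par n × Unk n) ε := by
      rw [mem_ball_zero_iff, Prod.norm_def, Prod.norm_def, Prod.norm_def, Prod.norm_def]
      exact max_lt (max_lt (by simpa using hε) (max_lt hrn (max_lt hδUn' hδPn'))) (by simpa using hε)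
    exact (hball _ hqb).1.1
  have hξ : AnalyticAt ℝ (fun y : 𝔼 => r⁻¹ • (y - x₀)) x₀ := by
    have : AnalyticAt ℝ (fun y : 𝔼 => y - x₀) x₀ := analyticAt_id.sub analyticAt_const
    exact (analyticAt_const (v := r⁻¹)).fun_smul this
  have hpar : AnalyticAt ℝ (fun y : 𝔼 => ((r⁻¹ • (y - x₀), r, δU, δP) : Par n)) x₀ :=
    hξ.prod analyticAt_const
  have hcomp : AnalyticAt ℝ (fun y : 𝔼 => ψ (r⁻¹ • (y - x₀), r, δU, δP)) x₀ := by
    refine AnalyticAt.fun_comp (g := ψ) ?_ hpar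
    simpa using hψ0
  have hT : AnalyticAt ℝ (fun y : 𝔼 => (((Hol.ev (0 : 𝔼)).comp Av).comp (ContinuousLinearMap.proj i₀ : Unk n →L[ℝ] Hol 𝔼))
      (ψ (r⁻¹ • (y - x₀), r, δU, δP))) x₀ := AnalyticAt.fun_comp (ContinuousLinearMap.analyticAt _ _) hcomp
  have hfin : AnalyticAt ℝ (fun y : 𝔼 => v x₀ - r * (((Hol.ev (0 : 𝔼)).comp Av).comp (ContinuousLinearMap.proj i₀ : Unk n →L[ℝ] Hol 𝔼))
      (ψ (r⁻¹ • (y - x₀), r, δU, δP))) x₀ := analyticAt_const.sub (analyticAt_const.mul hT)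
  refine hfin.congr ?_
  have htend : Tendsto (fun y : 𝔼 => r⁻¹ • (y - x₀)) (𝓝 x₀) (𝓝 0) := by
    have := hξ.continuousAt.tendsto
    simpa using this
  filter_upwards [htend.eventually rep] with y hy
  rw [smul_inv_smul₀ hr.ne', add_sub_cancel] at hy
  rw [hy]
  rfl
end
end RH
end


section
open Real Set
open Real Set MeasureTheory Filter Topology
namespace RH
theorem final {n : ℕ} (U : Set (EuclideanSpace ℝ (Fin n))) (hU : IsOpen U)
    (u : EuclideanSpace ℝ (Fin n) → ℝ) (hu : ContDiffOn ℝ 2 u U)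
    (hupos : ∀ x ∈ U, 0 < u x) (hharm : ∀ x ∈ U, relDiv u x = 0) : AnalyticOnNhd ℝ u U := by
  intro x₀ hx₀
  rcases Nat.eq_zero_or_pos n with hn | hn
  · subst hn
    have : u = fun _ => u x₀ := funext fun x => congrArg u (Subsingleton.elim _ _)
    rw [this]
    exact analyticAt_const
  obtain ⟨ρ, hρ, hball⟩ := Metric.isOpen_iff.1 hU x₀ hx₀
  let b : ContDiffBump x₀ := ⟨ρ / 4, ρ / 2, by positivity, by linarith⟩
  set v : EuclideanSpace ℝ (Fin n) → ℝ := fun x => b x * u x with hv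
  have bc : ContDiff ℝ 2 (fun x => b x) := b.contDiff
  have vu : ∀ x ∈ Metric.ball x₀ (ρ / 4), v x = u x := fun x hx => by
    have : b x = 1 := b.one_of_mem_closedBall (Metric.ball_subset_closedBall hx)
    simp [hv, this]
  have sub : Metric.ball x₀ (ρ / 4) ⊆ U := (Metric.ball_subset_ball (by linarith)).trans hball
  have vu' : ∀ x ∈ Metric.ball x₀ (ρ / 4), v =ᶠ[𝓝 x] u := fun x hx => by
    filter_upwards [Metric.isOpen_ball.mem_nhds hx] with y hy using vu y hy
  have vc : ContDiff ℝ 2 v := by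
    rw [contDiff_iff_contDiffAt]
    intro x
    by_cases hx : x ∈ U
    · exact bc.contDiffAt.mul (hu.contDiffAt (hU.mem_nhds hx))
    · have : v =ᶠ[𝓝 x] fun _ => 0 := by
        have hx' : ρ / 2 < dist x x₀ := by
          by_contra hcon
          exact hx (hball (Metric.mem_ball.2 (by linarith)))
        filter_upwards [(isOpen_lt continuous_const (continuous_id.dist continuous_const)).mem_nhds hx'] with y hy
        have : b y = 0 := b.zero_of_le_dist (le_of_lt hy)
        simp [hv, this]
      exact contDiffAt_const.congr_of_eventuallyEq this
  have vs : HasCompactSupport v := b.hasCompactSupport.mul_right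
  have pdv : ∀ x ∈ Metric.ball x₀ (ρ / 4), ∀ i, pd v i x = pd u i x := fun x hx i => pd_congr (vu' x hx) i
  have key : AnalyticAt ℝ v x₀ := by
    refine core (ρ₀ := ρ / 4) (by positivity) ⟨0, hn⟩ vc vs (fun x hx => by rw [vu x hx]; exact hupos x (sub hx)) fun x hx => ?_
    rw [← hharm x (sub hx)]
    unfold relDiv
    refine Finset.sum_congr rfl fun i _ => pd_congr ?_ i
    filter_upwards [Metric.isOpen_ball.mem_nhds hx] with y hy
    simp only [gradNormSq, pdv y hy, vu y hy]
  exact key.congr (vu' x₀ (Metric.mem_ball_self (by positivity)))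
end RH
end

/-- every relativistically harmonic function is real analytic. -/
theorem stmt11 {n : ℕ} (U : Set (EuclideanSpace ℝ (Fin n)))
    (hU : IsOpen U) (u : EuclideanSpace ℝ (Fin n) → ℝ)
    (hu : ContDiffOn ℝ 2 u U) (hupos : ∀ x ∈ U, 0 < u x)
    (hharm : ∀ x ∈ U, relDiv u x = 0) :
    AnalyticOnNhd ℝ u U := by
  exact RH.final U hU u hu hupos hharm
end
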